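/- arXiv:2410.11796 — 2 statements merged into one kernel-verified Lean document; each statement's English description precedes it below -/
import Mathlib

section
/- Let d ≥ 1 be an integer, 1 < p < ∞, m a nonnegative integer with m > d/p, and δ ∈ ℝ with δ + d/p ≥ 0. Then the weighted Sobolev norm is submultiplicative up to a constant: there exists C > 0 such that for all f, g ∈ C_c^∞(ℝ^d) one has ‖f·g‖_{W^{m,p}_δ} ≤ C ‖f‖_{W^{m,p}_δ} ‖g‖_{W^{m,p}_δ} (i.e., W^{m,p}_δ is a Banach algebra under pointwise multiplication). -/
open MeasureTheory

/-- Partial derivative in direction `j`. -/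
noncomputable def pd {d : ℕ} (j : Fin d) (f : (Fin d → ℝ) → ℝ) : (Fin d → ℝ) → ℝ :=
  fun x => fderiv ℝ f x (Pi.single j 1)

/-- Iterated partial derivative `∂^α`. -/
noncomputable def pdm {d : ℕ} (α : Fin d → ℕ) (f : (Fin d → ℝ) → ℝ) : (Fin d → ℝ) → ℝ :=
  (List.finRange d).foldr (fun j g => (pd j)^[α j] g) f

/-- Japanese bracket `⟨x⟩ = (1+|x|²)^{1/2}` with the Euclidean norm. -/
noncomputable def jap {d : ℕ} (x : Fin d → ℝ) : ℝ := Real.sqrt (1 + ∑ i, x i ^ 2)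

/-- The weighted Sobolev norm `‖f‖_{W^{m,p}_δ}`. -/
noncomputable def wnorm (d m : ℕ) (p δ : ℝ) (f : (Fin d → ℝ) → ℝ) : ℝ :=
  ∑ β : Fin d → Fin (m + 1),
    if (∑ j, (β j : ℕ)) ≤ m then
      (∫ x : Fin d → ℝ,
        jap x ^ ((δ + ((∑ j, (β j : ℕ)) : ℝ)) * p) *
          |pdm (fun j => (β j : ℕ)) f x| ^ p) ^ (1 / p)
    else 0


open scoped ENNReal

section Helpers

variable {d : ℕ}

lemma jap_ge_one (x : Fin d → ℝ) : 1 ≤ jap x := by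
  unfold jap
  rw [Real.one_le_sqrt]
  have : 0 ≤ ∑ i, x i ^ 2 := Finset.sum_nonneg fun i _ => sq_nonneg _
  linarith

lemma jap_pos (x : Fin d → ℝ) : 0 < jap x := lt_of_lt_of_le one_pos (jap_ge_one x)

lemma jap_cont : Continuous (jap : (Fin d → ℝ) → ℝ) := by
  unfold jap
  fun_prop

lemma jap_sq (x : Fin d → ℝ) : jap x ^ 2 = 1 + ∑ i, x i ^ 2 := by
  unfold jap
  rw [Real.sq_sqrt]
  have : 0 ≤ ∑ i, x i ^ 2 := Finset.sum_nonneg fun i _ => sq_nonneg _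
  linarith

lemma abs_le_jap (x : Fin d → ℝ) (i : Fin d) : |x i| ≤ jap x := by
  refine abs_le_of_sq_le_sq ?_ (jap_pos x).le
  rw [jap_sq]
  have := Finset.single_le_sum (f := fun i => x i ^ 2) (fun i _ => sq_nonneg _) (Finset.mem_univ i)
  linarith

lemma jap_add_le (x v : Fin d → ℝ) : jap (x + v) ≤ jap x + d * ‖v‖ := by
  have hL : ∑ i, |v i| ≤ d * ‖v‖ := by
    calc ∑ i, |v i| ≤ ∑ i : Fin d, ‖v‖ := Finset.sum_le_sum fun i _ => norm_le_pi_norm v i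
      _ = d * ‖v‖ := by simp
  have hL0 : 0 ≤ ∑ i, |v i| := Finset.sum_nonneg fun i _ => abs_nonneg _
  refine le_trans ?_ (add_le_add_right hL _)
  apply abs_le_of_sq_le_sq' _ (by have := jap_pos x; positivity) |>.2
  rw [jap_sq, add_sq, jap_sq]
  have h1 : ∑ i, v i ^ 2 ≤ (∑ i, |v i|) ^ 2 := by
    calc ∑ i, v i ^ 2 = ∑ i, |v i| ^ 2 := by simp
      _ ≤ _ := Finset.sum_sq_le_sq_sum_of_nonneg (fun i _ => abs_nonneg _)
  have h2 : ∑ i, 2 * x i * v i ≤ 2 * jap x * ∑ i, |v i| := by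
    rw [Finset.mul_sum]
    apply Finset.sum_le_sum
    intro i _
    have := abs_le_jap x i
    calc 2 * x i * v i ≤ |2 * x i * v i| := le_abs_self _
      _ = 2 * |x i| * |v i| := by simp [abs_mul]
      _ ≤ _ := by gcongr
  have h3 : ∑ i, (x + v) i ^ 2 = ∑ i, x i ^ 2 + ∑ i, 2 * x i * v i + ∑ i, v i ^ 2 := by
    rw [← Finset.sum_add_distrib, ← Finset.sum_add_distrib]
    congr 1; ext i; simp; ring
  rw [h3]; linarith

/-- comparability -/
lemma jap_comp (hd : 1 ≤ d) (x v : Fin d → ℝ) (hv : ‖v‖ ≤ jap x / (2 * d)) :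
    jap x ≤ 2 * jap (x + v) ∧ jap (x + v) ≤ 2 * jap x := by
  have hd' : (0 : ℝ) < d := by exact_mod_cast hd
  have h0 : d * ‖v‖ ≤ jap x / 2 := by
    calc d * ‖v‖ ≤ d * (jap x / (2 * d)) := by gcongr
      _ = _ := by field_simp
  have h1 := jap_add_le x v
  have h2 := jap_add_le (x + v) (-v)
  simp only [add_neg_cancel_right, norm_neg] at h2
  have := jap_pos x
  constructor <;> linarith

lemma rpow_comp {a b : ℝ} (e : ℝ) (ha : 0 < a) (hb : 0 < b) (h1 : a ≤ 2 * b) (h2 : b ≤ 2 * a) :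
    a ^ e ≤ 2 ^ |e| * b ^ e := by
  rcases le_total 0 e with he | he
  · rw [abs_of_nonneg he, ← Real.mul_rpow (by norm_num) hb.le]
    exact Real.rpow_le_rpow ha.le h1 he
  · rw [abs_of_nonpos he, Real.rpow_neg (by norm_num), ← Real.inv_rpow (by norm_num), ← Real.mul_rpow (by norm_num) hb.le]
    apply Real.rpow_le_rpow_of_nonpos (by positivity) _ he
    linarith

lemma ofReal_rpow_comp {a b : ℝ} (e : ℝ) (ha : 0 < a) (hb : 0 < b) (h1 : a ≤ 2 * b) (h2 : b ≤ 2 * a) :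
    ENNReal.ofReal (a ^ e) ≤ ENNReal.ofReal (2 ^ |e|) * ENNReal.ofReal (b ^ e) := by
  rw [← ENNReal.ofReal_mul (by positivity)]
  exact ENNReal.ofReal_le_ofReal (rpow_comp e ha hb h1 h2)

/-- fundamental theorem bound -/
lemma ftc_bound (φ : ℝ → ℝ) (hφ : ContDiff ℝ 1 φ) (a b : ℝ) (S : Set ℝ) (hS : Set.uIoc a b ⊆ S) :
    ‖φ a‖ₑ ≤ ‖φ b‖ₑ + ∫⁻ r in S, ‖deriv φ r‖ₑ := by
  have h : ∫ r in a..b, deriv φ r = φ b - φ a := by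
    apply intervalIntegral.integral_deriv_eq_sub
    · intro x _; exact (hφ.differentiable one_ne_zero) x
    · exact (hφ.continuous_deriv le_rfl).intervalIntegrable _ _
  have h2 : ‖φ b - φ a‖ₑ ≤ ∫⁻ r in S, ‖deriv φ r‖ₑ := by
    rw [← h]
    have h3 : ‖∫ r in a..b, deriv φ r‖ₑ = ‖∫ r in Set.uIoc a b, deriv φ r‖ₑ := by
      rw [enorm_eq_iff_norm_eq, intervalIntegral.norm_intervalIntegral_eq]
    rw [h3]
    exact (enorm_integral_le_lintegral_enorm _).trans (lintegral_mono_set hS)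
  calc ‖φ a‖ₑ = ‖φ b - (φ b - φ a)‖ₑ := by congr 1; ring
    _ ≤ ‖φ b‖ₑ + ‖φ b - φ a‖ₑ := enorm_sub_le
    _ ≤ _ := by gcongr

lemma base1d (φ : ℝ → ℝ) (hφ : ContDiff ℝ 1 φ) :
    ‖φ 0‖ₑ ≤ ∫⁻ t in Set.Ioc (0:ℝ) 1, (‖φ t‖ₑ + ‖deriv φ t‖ₑ) := by
  have hc : Continuous (deriv φ) := hφ.continuous_deriv le_rfl
  have hc0 := hφ.continuous
  have h : ∫⁻ t in Set.Ioc (0:ℝ) 1, ‖φ 0‖ₑ ≤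
      ∫⁻ t in Set.Ioc (0:ℝ) 1, (‖φ t‖ₑ + ∫⁻ r in Set.Ioc (0:ℝ) 1, ‖deriv φ r‖ₑ) := by
    apply setLIntegral_mono (by fun_prop)
    intro t ht
    apply ftc_bound φ hφ
    rw [Set.uIoc_of_le ht.1.le]
    exact Set.Ioc_subset_Ioc_right ht.2
  rw [lintegral_add_left (by fun_prop)] at h ⊢
  simpa using h

lemma step1d (k : ℕ) (φ : ℝ → ℝ) (hφ : ContDiff ℝ 1 φ) :
    ∫⁻ t in Set.Ioc (0:ℝ) 1, ENNReal.ofReal (t ^ k) * ‖φ t‖ₑ ≤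
      2 ^ (k + 2) * ∫⁻ t in Set.Ioc (0:ℝ) 1, ENNReal.ofReal (t ^ (k + 1)) * (‖φ t‖ₑ + ‖deriv φ t‖ₑ) := by
  have hc : Continuous (deriv φ) := hφ.continuous_deriv le_rfl
  have hc0 := hφ.continuous
  -- pointwise bound
  have hp : ∀ t ∈ Set.Ioc (0:ℝ) 1, ‖φ t‖ₑ ≤ 2 * (∫⁻ s in Set.Ioc (1/2:ℝ) 1, ‖φ s‖ₑ) +
      ∫⁻ r in Set.Ioc (0:ℝ) 1, (if t ≤ 2 * r then ‖deriv φ r‖ₑ else 0) := by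
    intro t ht
    have key : ∀ s ∈ Set.Ioc (1/2:ℝ) 1, ‖φ t‖ₑ ≤ ‖φ s‖ₑ +
      ∫⁻ r in Set.Ioc (0:ℝ) 1, (if t ≤ 2 * r then ‖deriv φ r‖ₑ else 0) := by
      intro s hs
      refine (ftc_bound φ hφ t s _ subset_rfl).trans ?_
      refine add_le_add le_rfl ?_
      have hsub : Set.uIoc t s ⊆ Set.Ioc (0:ℝ) 1 := by
        intro r hr
        rcases Set.mem_uIoc.1 hr with h | h
        · exact ⟨ht.1.trans h.1, h.2.trans hs.2⟩
        · exact ⟨by linarith [hs.1, h.1], h.2.trans ht.2⟩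
      calc ∫⁻ r in Set.uIoc t s, ‖deriv φ r‖ₑ
          = ∫⁻ r in Set.uIoc t s, (if t ≤ 2 * r then ‖deriv φ r‖ₑ else 0) := by
            apply setLIntegral_congr_fun measurableSet_uIoc
            intro r hr
            have : t ≤ 2 * r := by
              rcases Set.mem_uIoc.1 hr with h | h
              · linarith [h.1, ht.1]
              · linarith [h.1, hs.1, ht.2]
            simp [this]
        _ ≤ _ := lintegral_mono_set hsub
    have h := setLIntegral_mono (μ := volume) (by fun_prop) key
    rw [lintegral_add_left (by fun_prop)] at h
    simp only [lintegral_const, Measure.restrict_apply MeasurableSet.univ, Set.univ_inter, Real.volume_Ioc] at h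
    have hh : ENNReal.ofReal (1 - 1/2) = 2⁻¹ := by
      rw [show (1 - 1/2 : ℝ) = 2⁻¹ by norm_num, ENNReal.ofReal_inv_of_pos (by norm_num)]; simp
    rw [hh] at h
    have h4 := mul_le_mul_right h (2:ℝ≥0∞)
    have e : ∀ a : ℝ≥0∞, 2 * (a * 2⁻¹) = a := by
      intro a
      rw [mul_comm a, ← mul_assoc, ENNReal.mul_inv_cancel (by simp) (by simp), one_mul]
    rw [mul_add, e, e] at h4
    exact h4
  have hA : (∫⁻ s in Set.Ioc (1/2:ℝ) 1, ‖φ s‖ₑ) ≤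
      2 ^ (k+1) * ∫⁻ t in Set.Ioc (0:ℝ) 1, ENNReal.ofReal (t ^ (k + 1)) * ‖φ t‖ₑ := by
    rw [← lintegral_const_mul _ (by fun_prop)]
    refine le_trans ?_ (lintegral_mono_set (s := Set.Ioc (1/2:ℝ) 1) (Set.Ioc_subset_Ioc_left (by norm_num)))
    apply setLIntegral_mono (by fun_prop)
    intro s hs
    rw [← mul_assoc]
    have : (1:ℝ≥0∞) ≤ 2 ^ (k+1) * ENNReal.ofReal (s ^ (k+1)) := by
      rw [ENNReal.ofReal_pow (by linarith [hs.1]), ← mul_pow]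
      apply one_le_pow₀
      rw [← ENNReal.ofReal_ofNat, ← ENNReal.ofReal_mul (by norm_num), ENNReal.one_le_ofReal]
      linarith [hs.1]
    calc ‖φ s‖ₑ = 1 * ‖φ s‖ₑ := by simp
      _ ≤ _ := by gcongr
  have hB : ∫⁻ t in Set.Ioc (0:ℝ) 1, ENNReal.ofReal (t ^ k) *
        ∫⁻ r in Set.Ioc (0:ℝ) 1, (if t ≤ 2 * r then ‖deriv φ r‖ₑ else 0) ≤
      2 ^ (k+1) * ∫⁻ t in Set.Ioc (0:ℝ) 1, ENNReal.ofReal (t ^ (k + 1)) * ‖deriv φ t‖ₑ := by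
    have hm : Measurable (fun z : ℝ × ℝ => if z.1 ≤ 2 * z.2 then ‖deriv φ z.2‖ₑ else 0) := by
      apply Measurable.ite
      · exact measurableSet_le (by fun_prop) (by fun_prop)
      · fun_prop
      · fun_prop
    have e1 : ∀ t : ℝ, ENNReal.ofReal (t ^ k) *
        ∫⁻ r in Set.Ioc (0:ℝ) 1, (if t ≤ 2 * r then ‖deriv φ r‖ₑ else 0) =
        ∫⁻ r in Set.Ioc (0:ℝ) 1, ENNReal.ofReal (t ^ k) * (if t ≤ 2 * r then ‖deriv φ r‖ₑ else 0) := by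
      intro t
      rw [lintegral_const_mul]
      exact hm.comp (by fun_prop : Measurable fun r : ℝ => (t, r))
    simp_rw [e1]
    rw [lintegral_lintegral_swap]
    swap
    · apply Measurable.aemeasurable
      exact Measurable.mul (by fun_prop) hm
    rw [← lintegral_const_mul _ (by fun_prop)]
    apply setLIntegral_mono (by fun_prop)
    intro r hr
    have hr0 := hr.1
    calc ∫⁻ t in Set.Ioc (0:ℝ) 1, ENNReal.ofReal (t ^ k) * (if t ≤ 2 * r then ‖deriv φ r‖ₑ else 0)
        ≤ ∫⁻ t in Set.Ioc (0:ℝ) 1, (Set.Ioc 0 (2 * r)).indicator (fun _ => ENNReal.ofReal ((2 * r) ^ k) * ‖deriv φ r‖ₑ) t := by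
          apply setLIntegral_mono (by fun_prop (disch := measurability))
          intro t ht
          by_cases h : t ≤ 2 * r
          · rw [Set.indicator_of_mem (show t ∈ Set.Ioc 0 (2 * r) from ⟨ht.1, h⟩), if_pos h]
            gcongr
            exact ht.1.le
          · simp [h]
      _ ≤ ∫⁻ t, (Set.Ioc 0 (2 * r)).indicator (fun _ => ENNReal.ofReal ((2 * r) ^ k) * ‖deriv φ r‖ₑ) t :=
          setLIntegral_le_lintegral _ _
      _ = ENNReal.ofReal ((2 * r) ^ k) * ‖deriv φ r‖ₑ * ENNReal.ofReal (2 * r) := by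
          rw [lintegral_indicator measurableSet_Ioc]; simp
      _ = _ := by
          rw [mul_right_comm, ← ENNReal.ofReal_mul (by positivity), ← pow_succ, mul_pow,
            ENNReal.ofReal_mul (by positivity), mul_assoc, ENNReal.ofReal_pow (by norm_num)]
          simp
  calc ∫⁻ t in Set.Ioc (0:ℝ) 1, ENNReal.ofReal (t ^ k) * ‖φ t‖ₑ
      ≤ ∫⁻ t in Set.Ioc (0:ℝ) 1, (2 * (∫⁻ s in Set.Ioc (1/2:ℝ) 1, ‖φ s‖ₑ) + ENNReal.ofReal (t ^ k) *
        ∫⁻ r in Set.Ioc (0:ℝ) 1, (if t ≤ 2 * r then ‖deriv φ r‖ₑ else 0)) := by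
        apply setLIntegral_mono' measurableSet_Ioc
        intro t ht
        calc _ ≤ ENNReal.ofReal (t ^ k) * (_ + _) := by gcongr; exact hp t ht
          _ ≤ _ := by
            rw [mul_add]
            refine add_le_add ?_ le_rfl
            apply mul_le_of_le_one_left (by simp)
            rw [ENNReal.ofReal_le_one]
            exact pow_le_one₀ ht.1.le ht.2
    _ = 2 * (∫⁻ s in Set.Ioc (1/2:ℝ) 1, ‖φ s‖ₑ) + ∫⁻ t in Set.Ioc (0:ℝ) 1, ENNReal.ofReal (t ^ k) *
        ∫⁻ r in Set.Ioc (0:ℝ) 1, (if t ≤ 2 * r then ‖deriv φ r‖ₑ else 0) := by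
        rw [lintegral_add_left (by fun_prop)]; simp
    _ ≤ 2 * (2 ^ (k+1) * ∫⁻ t in Set.Ioc (0:ℝ) 1, ENNReal.ofReal (t ^ (k + 1)) * ‖φ t‖ₑ) +
      2 * (2 ^ (k+1) * ∫⁻ t in Set.Ioc (0:ℝ) 1, ENNReal.ofReal (t ^ (k + 1)) * ‖deriv φ t‖ₑ) := by
        gcongr
        refine hB.trans ?_
        apply le_mul_of_one_le_left (by simp) (by simp)
    _ = _ := by
        simp_rw [mul_add]
        rw [lintegral_add_left (by fun_prop)]
        ring


noncomputable def g0 (e : ℝ) (u : (Fin d → ℝ) → ℝ) (z : Fin d → ℝ) : ℝ≥0∞ :=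
  ENNReal.ofReal (jap z ^ e) * ‖u z‖ₑ

noncomputable def GG : ℕ → ℝ → ((Fin d → ℝ) → ℝ) → (Fin d → ℝ) → ℝ≥0∞
  | 0, e, u, z => g0 e u z
  | k + 1, e, u, z => g0 e u z + ∑ i, GG k (e + 1) (pd i u) z

lemma pd_smooth (i : Fin d) {u : (Fin d → ℝ) → ℝ} (hu : ContDiff ℝ (⊤ : ℕ∞) u) :
    ContDiff ℝ (⊤ : ℕ∞) (pd i u) := by
  unfold pd
  exact (hu.fderiv_right (m := (⊤ : ℕ∞)) (by norm_cast)).clm_apply contDiff_const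

lemma g0_meas (e : ℝ) {u : (Fin d → ℝ) → ℝ} (hu : ContDiff ℝ (⊤ : ℕ∞) u) : Measurable (g0 e u) := by
  unfold g0
  have := hu.continuous.measurable
  have h2 := (jap_cont (d := d)).measurable
  fun_prop

lemma GG_meas (k : ℕ) : ∀ (e : ℝ) {u : (Fin d → ℝ) → ℝ} (_ : ContDiff ℝ (⊤ : ℕ∞) u),
    Measurable (GG k e u) := by
  induction k with
  | zero => intro e u hu; exact g0_meas e hu
  | succ k ih =>
    intro e u hu
    change Measurable (fun z => g0 e u z + ∑ i, GG k (e + 1) (pd i u) z)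
    exact (g0_meas e hu).add (Finset.measurable_fun_sum _ fun i _ => ih _ (pd_smooth i hu))

lemma g0_le_GG (k : ℕ) (e : ℝ) (u : (Fin d → ℝ) → ℝ) (z : Fin d → ℝ) : g0 e u z ≤ GG k e u z := by
  cases k with
  | zero => exact le_rfl
  | succ k => exact le_self_add

lemma path_smooth {u : (Fin d → ℝ) → ℝ} (hu : ContDiff ℝ (⊤ : ℕ∞) u) (x v : Fin d → ℝ) :
    ContDiff ℝ 1 (fun t : ℝ => u (x + t • v)) := by
  have : ContDiff ℝ 1 u := hu.of_le (by norm_cast)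
  fun_prop

lemma path_deriv {u : (Fin d → ℝ) → ℝ} (hu : ContDiff ℝ (⊤ : ℕ∞) u) (x v : Fin d → ℝ) (t : ℝ) :
    deriv (fun t : ℝ => u (x + t • v)) t = ∑ i, v i * pd i u (x + t • v) := by
  have hu1 : Differentiable ℝ u := hu.differentiable (by norm_cast)
  have h1 : HasDerivAt (fun t : ℝ => x + t • v) v t := by
    simpa using ((hasDerivAt_id t).smul_const v).const_add x
  have h2 := (hu1 (x + t • v)).hasFDerivAt.comp_hasDerivAt t h1
  have h3 := h2.deriv
  rw [Function.comp_def] at h3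
  rw [h3]
  have h4 : v = ∑ i, v i • (Pi.single i (1:ℝ) : Fin d → ℝ) := by
    ext j; simp [Finset.sum_apply, Pi.single_apply]
  calc fderiv ℝ u (x + t • v) v = fderiv ℝ u (x + t • v) (∑ i, v i • (Pi.single i (1:ℝ) : Fin d → ℝ)) := by
        rw [← h4]
    _ = _ := by rw [map_sum]; simp [pd]

lemma path_vec (hd : 1 ≤ d) (x v : Fin d → ℝ) (hv : ‖v‖ ≤ jap x / (2 * d)) (t : ℝ)
    (ht : t ∈ Set.Ioc (0:ℝ) 1) : jap x ≤ 2 * jap (x + t • v) ∧ jap (x + t • v) ≤ 2 * jap x := by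
  apply jap_comp hd
  rw [norm_smul, Real.norm_of_nonneg ht.1.le]
  exact (mul_le_of_le_one_left (norm_nonneg _) ht.2).trans hv

lemma path_bound (hd : 1 ≤ d) (e : ℝ) {u : (Fin d → ℝ) → ℝ} (hu : ContDiff ℝ (⊤ : ℕ∞) u)
    (x v : Fin d → ℝ) (hv : ‖v‖ ≤ jap x / (2 * d)) (t : ℝ) (ht : t ∈ Set.Ioc (0:ℝ) 1) :
    ENNReal.ofReal (jap x ^ e) * (‖u (x + t • v)‖ₑ + ‖deriv (fun t : ℝ => u (x + t • v)) t‖ₑ) ≤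
      ENNReal.ofReal (2 ^ |e| + 2 ^ |e + 1|) * GG 1 e u (x + t • v) := by
  obtain ⟨h1, h2⟩ := path_vec hd x v hv t ht
  have hx := jap_pos x
  have hz := jap_pos (x + t • v)
  have hd' : (1 : ℝ) ≤ d := by exact_mod_cast hd
  set z := x + t • v with hzdef
  have hvi : ∀ i, ‖v i‖ₑ ≤ ENNReal.ofReal (jap x) := by
    intro i
    rw [Real.enorm_eq_ofReal_abs]
    apply ENNReal.ofReal_le_ofReal
    refine (norm_le_pi_norm v i).trans (hv.trans ?_)
    exact div_le_self hx.le (by linarith)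
  have hder : ‖deriv (fun t : ℝ => u (x + t • v)) t‖ₑ ≤ ENNReal.ofReal (jap x) * ∑ i, ‖pd i u z‖ₑ := by
    rw [path_deriv hu, Finset.mul_sum]
    refine (enorm_sum_le _ _).trans ?_
    apply Finset.sum_le_sum
    intro i _
    rw [enorm_mul]
    gcongr
    exact hvi i
  have hA : ENNReal.ofReal (2 ^ |e|) ≤ ENNReal.ofReal (2 ^ |e| + 2 ^ |e + 1|) :=
    ENNReal.ofReal_le_ofReal (by linarith [Real.rpow_pos_of_pos (show (0:ℝ) < 2 by norm_num) |e + 1|])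
  have hB : ENNReal.ofReal (2 ^ |e + 1|) ≤ ENNReal.ofReal (2 ^ |e| + 2 ^ |e + 1|) :=
    ENNReal.ofReal_le_ofReal (by linarith [Real.rpow_pos_of_pos (show (0:ℝ) < 2 by norm_num) |e|])
  set C := ENNReal.ofReal (2 ^ |e| + 2 ^ |e + 1|)
  change _ ≤ C * (g0 e u z + ∑ i, g0 (e + 1) (pd i u) z)
  rw [mul_add, mul_add]
  apply add_le_add
  · unfold g0
    rw [← mul_assoc]
    gcongr
    exact (ofReal_rpow_comp e hx hz h1 h2).trans (by gcongr)
  · calc _ ≤ ENNReal.ofReal (jap x ^ e) * (ENNReal.ofReal (jap x) * ∑ i, ‖pd i u z‖ₑ) := by gcongr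
      _ = ENNReal.ofReal (jap x ^ (e + 1)) * ∑ i, ‖pd i u z‖ₑ := by
        rw [← mul_assoc, ← ENNReal.ofReal_mul (by positivity), Real.rpow_add_one hx.ne']
      _ ≤ (C * ENNReal.ofReal (jap z ^ (e + 1))) * ∑ i, ‖pd i u z‖ₑ := by
        gcongr
        exact (ofReal_rpow_comp (e + 1) hx hz h1 h2).trans (by gcongr)
      _ = _ := by
        unfold g0
        rw [mul_assoc, Finset.mul_sum]

lemma GG1_le (j : ℕ) (e : ℝ) (u : (Fin d → ℝ) → ℝ) (z : Fin d → ℝ) : GG 1 e u z ≤ GG (j + 1) e u z := by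
  change g0 e u z + ∑ i, g0 (e + 1) (pd i u) z ≤ g0 e u z + ∑ i, GG j (e + 1) (pd i u) z
  gcongr
  exact g0_le_GG _ _ _ _

lemma comp_meas {F : (Fin d → ℝ) → ℝ≥0∞} (hF : Measurable F) (x v : Fin d → ℝ) :
    Measurable (fun t : ℝ => F (x + t • v)) := hF.comp (by fun_prop)

lemma step_g0 (hd : 1 ≤ d) (k : ℕ) (e : ℝ) : ∃ C : ℝ≥0∞, C ≠ ∞ ∧
    ∀ {u : (Fin d → ℝ) → ℝ} (_ : ContDiff ℝ (⊤ : ℕ∞) u)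
    (x v : Fin d → ℝ) (_ : ‖v‖ ≤ jap x / (2 * d)),
    ∫⁻ t in Set.Ioc (0:ℝ) 1, ENNReal.ofReal (t ^ k) * g0 e u (x + t • v) ≤
      C * ∫⁻ t in Set.Ioc (0:ℝ) 1, ENNReal.ofReal (t ^ (k + 1)) * GG 1 e u (x + t • v) := by
  refine ⟨ENNReal.ofReal (2 ^ |e|) * (2 ^ (k + 2) * ENNReal.ofReal (2 ^ |e| + 2 ^ |e + 1|)), ?_, ?_⟩
  · finiteness
  intro u hu x v hv
  have hs := path_smooth hu x v
  have hcu := hu.continuous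
  have hcum := hcu.measurable
  have hc0 := hs.continuous
  have hc1 := hs.continuous_deriv le_rfl
  have hx := jap_pos x
  have hm := comp_meas (GG_meas 1 e hu) x v
  calc ∫⁻ t in Set.Ioc (0:ℝ) 1, ENNReal.ofReal (t ^ k) * g0 e u (x + t • v)
      ≤ ∫⁻ t in Set.Ioc (0:ℝ) 1, (ENNReal.ofReal (2 ^ |e|) * ENNReal.ofReal (jap x ^ e)) *
          (ENNReal.ofReal (t ^ k) * ‖u (x + t • v)‖ₑ) := by
        apply setLIntegral_mono (by fun_prop)
        intro t ht
        obtain ⟨h1, h2⟩ := path_vec hd x v hv t ht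
        have := ofReal_rpow_comp e (jap_pos (x + t • v)) hx h2 h1
        unfold g0
        calc _ ≤ ENNReal.ofReal (t ^ k) * ((ENNReal.ofReal (2 ^ |e|) * ENNReal.ofReal (jap x ^ e)) * ‖u (x + t • v)‖ₑ) := by
              gcongr
          _ = _ := by ring
    _ = (ENNReal.ofReal (2 ^ |e|) * ENNReal.ofReal (jap x ^ e)) * ∫⁻ t in Set.Ioc (0:ℝ) 1,
          (ENNReal.ofReal (t ^ k) * ‖u (x + t • v)‖ₑ) := by
        rw [lintegral_const_mul _ (by fun_prop)]
    _ ≤ (ENNReal.ofReal (2 ^ |e|) * ENNReal.ofReal (jap x ^ e)) * (2 ^ (k + 2) * ∫⁻ t in Set.Ioc (0:ℝ) 1,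
          ENNReal.ofReal (t ^ (k + 1)) * (‖u (x + t • v)‖ₑ + ‖deriv (fun t : ℝ => u (x + t • v)) t‖ₑ)) := by
        gcongr
        exact step1d k _ hs
    _ = ENNReal.ofReal (2 ^ |e|) * (2 ^ (k + 2) * ∫⁻ t in Set.Ioc (0:ℝ) 1, ENNReal.ofReal (t ^ (k + 1)) * (ENNReal.ofReal (jap x ^ e) *
           (‖u (x + t • v)‖ₑ + ‖deriv (fun t : ℝ => u (x + t • v)) t‖ₑ))) := by
        simp_rw [mul_left_comm _ (ENNReal.ofReal (jap x ^ e)) _]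
        rw [lintegral_const_mul _ (by fun_prop)]
        ring
    _ ≤ ENNReal.ofReal (2 ^ |e|) * (2 ^ (k + 2) * ∫⁻ t in Set.Ioc (0:ℝ) 1, ENNReal.ofReal (t ^ (k + 1)) *
          (ENNReal.ofReal (2 ^ |e| + 2 ^ |e + 1|) * GG 1 e u (x + t • v))) := by
        gcongr 2
        apply setLIntegral_mono (by fun_prop)
        intro t ht
        exact mul_le_mul_right (path_bound hd e hu x v hv t ht) _
    _ = _ := by
        simp_rw [mul_left_comm _ (ENNReal.ofReal (2 ^ |e| + 2 ^ |e + 1|)) _]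
        rw [lintegral_const_mul _ (by fun_prop)]
        ring

lemma base_g0 (hd : 1 ≤ d) (e : ℝ) : ∃ C : ℝ≥0∞, C ≠ ∞ ∧
    ∀ {u : (Fin d → ℝ) → ℝ} (_ : ContDiff ℝ (⊤ : ℕ∞) u)
    (x v : Fin d → ℝ) (_ : ‖v‖ ≤ jap x / (2 * d)),
    g0 e u x ≤ C * ∫⁻ t in Set.Ioc (0:ℝ) 1, GG 1 e u (x + t • v) := by
  refine ⟨ENNReal.ofReal (2 ^ |e| + 2 ^ |e + 1|), by finiteness, ?_⟩
  intro u hu x v hv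
  have hs := path_smooth hu x v
  have hcu := hu.continuous
  have hcum := hcu.measurable
  have hc0 := hs.continuous
  have hc1 := hs.continuous_deriv le_rfl
  have hm := comp_meas (GG_meas 1 e hu) x v
  have h := base1d _ hs
  simp only [zero_smul, add_zero] at h
  unfold g0
  calc _ ≤ ENNReal.ofReal (jap x ^ e) * ∫⁻ t in Set.Ioc (0:ℝ) 1, (‖u (x + t • v)‖ₑ + ‖deriv (fun t : ℝ => u (x + t • v)) t‖ₑ) := by gcongr
    _ = ∫⁻ t in Set.Ioc (0:ℝ) 1, ENNReal.ofReal (jap x ^ e) * (‖u (x + t • v)‖ₑ + ‖deriv (fun t : ℝ => u (x + t • v)) t‖ₑ) := by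
      rw [lintegral_const_mul _ (by fun_prop)]
    _ ≤ ∫⁻ t in Set.Ioc (0:ℝ) 1, ENNReal.ofReal (2 ^ |e| + 2 ^ |e + 1|) * GG 1 e u (x + t • v) := by
      apply setLIntegral_mono (by fun_prop)
      intro t ht
      exact path_bound hd e hu x v hv t ht
    _ = _ := by rw [lintegral_const_mul _ (by fun_prop)]

lemma step_GG (hd : 1 ≤ d) (k j : ℕ) : ∀ (e : ℝ), ∃ C : ℝ≥0∞, C ≠ ∞ ∧
    ∀ {u : (Fin d → ℝ) → ℝ} (_ : ContDiff ℝ (⊤ : ℕ∞) u)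
    (x v : Fin d → ℝ) (_ : ‖v‖ ≤ jap x / (2 * d)),
    ∫⁻ t in Set.Ioc (0:ℝ) 1, ENNReal.ofReal (t ^ k) * GG j e u (x + t • v) ≤
      C * ∫⁻ t in Set.Ioc (0:ℝ) 1, ENNReal.ofReal (t ^ (k + 1)) * GG (j + 1) e u (x + t • v) := by
  induction j with
  | zero => exact fun e => step_g0 hd k e
  | succ j ih =>
    intro e
    obtain ⟨C1, hC1, h1⟩ := step_g0 hd k e
    obtain ⟨C2, hC2, h2⟩ := ih (e + 1)
    refine ⟨C1 + C2, by finiteness, ?_⟩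
    intro u hu x v hv
    have hm := comp_meas (g0_meas e hu) x v
    have hm' : ∀ n, ∀ i, Measurable (fun t : ℝ => GG n (e + 1) (pd i u) (x + t • v)) :=
      fun n i => comp_meas (GG_meas n (e+1) (pd_smooth i hu)) x v
    change ∫⁻ t in Set.Ioc (0:ℝ) 1, ENNReal.ofReal (t ^ k) * (g0 e u (x + t • v) + ∑ i, GG j (e + 1) (pd i u) (x + t • v)) ≤ _
    simp_rw [mul_add]
    rw [lintegral_add_left (by fun_prop), add_mul]
    apply add_le_add
    · refine (h1 hu x v hv).trans ?_
      gcongr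
      exact GG1_le _ _ _ _
    · simp_rw [Finset.mul_sum]
      rw [lintegral_finsetSum _ (fun i _ => by have := hm' j i; fun_prop)]
      calc _ ≤ ∑ i, C2 * ∫⁻ t in Set.Ioc (0:ℝ) 1, ENNReal.ofReal (t ^ (k + 1)) * GG (j + 1) (e + 1) (pd i u) (x + t • v) :=
            Finset.sum_le_sum fun i _ => h2 (pd_smooth i hu) x v hv
        _ = C2 * ∫⁻ t in Set.Ioc (0:ℝ) 1, ∑ i, ENNReal.ofReal (t ^ (k + 1)) * GG (j + 1) (e + 1) (pd i u) (x + t • v) := by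
            rw [← Finset.mul_sum, lintegral_finsetSum _ (fun i _ => by have := hm' (j+1) i; fun_prop)]
        _ ≤ _ := by
            gcongr
            rw [← Finset.mul_sum]
            gcongr
            exact le_add_self

lemma point_GG (hd : 1 ≤ d) (e : ℝ) (k : ℕ) : ∃ C : ℝ≥0∞, C ≠ ∞ ∧
    ∀ {u : (Fin d → ℝ) → ℝ} (_ : ContDiff ℝ (⊤ : ℕ∞) u)
    (x v : Fin d → ℝ) (_ : ‖v‖ ≤ jap x / (2 * d)),
    g0 e u x ≤ C * ∫⁻ t in Set.Ioc (0:ℝ) 1, ENNReal.ofReal (t ^ k) * GG (k + 1) e u (x + t • v) := by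
  induction k with
  | zero => simpa using base_g0 hd e
  | succ k ih =>
    obtain ⟨C1, hC1, h1⟩ := ih
    obtain ⟨C2, hC2, h2⟩ := step_GG hd k (k + 1) e
    refine ⟨C1 * C2, by finiteness, ?_⟩
    intro u hu x v hv
    refine (h1 hu x v hv).trans ?_
    rw [mul_assoc]
    gcongr
    exact h2 hu x v hv

lemma rpow_fin {σ : ℝ} (hσ : -1 < σ) : ∫⁻ t in Set.Ioc (0:ℝ) 1, ENNReal.ofReal (t ^ σ) ≠ ∞ := by
  have h := (intervalIntegral.intervalIntegrable_rpow' hσ (a := 0) (b := 1))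
  rw [intervalIntegrable_iff_integrableOn_Ioc_of_le zero_le_one] at h
  have h2 := h.2
  rw [HasFiniteIntegral] at h2
  refine ne_of_lt (lt_of_le_of_lt ?_ h2)
  apply lintegral_mono
  intro t
  exact Real.ofReal_le_enorm _

lemma holder1 (k : ℕ) {p σ : ℝ} (hp : 1 < p) (hσ : σ < (k + 1) * p - 1) : ∃ C : ℝ≥0∞, C ≠ ∞ ∧
    ∀ g : ℝ → ℝ≥0∞, Measurable g →
      (∫⁻ t in Set.Ioc (0:ℝ) 1, ENNReal.ofReal (t ^ k) * g t) ^ p ≤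
        C * ∫⁻ t in Set.Ioc (0:ℝ) 1, ENNReal.ofReal (t ^ σ) * g t ^ p := by
  have hpq := Real.HolderConjugate.conjExponent hp
  set q := p.conjExponent
  have hp0 : 0 < p := by linarith
  have hq0 : 0 < q := hpq.symm.pos
  have hex : -1 < (k - σ / p) * q := by
    have h1 : σ / p < k + 1 - 1 / p := by
      rw [div_lt_iff₀ hp0]; field_simp; linarith
    have h2 : 1 / p = 1 - 1 / q := by
      have := hpq.inv_add_inv_eq_one
      simp only [one_div]; linarith
    have h3 : - (1 / q) < k - σ / p := by linarith
    calc (-1 : ℝ) = -(1/q) * q := by field_simp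
      _ < _ := by gcongr
  refine ⟨((∫⁻ t in Set.Ioc (0:ℝ) 1, ENNReal.ofReal (t ^ ((k - σ / p) * q))) ^ (1 / q)) ^ p, ?_, ?_⟩
  · have := rpow_fin hex
    exact ENNReal.rpow_ne_top_of_nonneg hp0.le (ENNReal.rpow_ne_top_of_nonneg (by positivity) this)
  intro g hg
  have h := ENNReal.lintegral_mul_le_Lp_mul_Lq (volume.restrict (Set.Ioc (0:ℝ) 1)) hpq
    (f := fun t => ENNReal.ofReal (t ^ (σ / p)) * g t) (g := fun t => ENNReal.ofReal (t ^ (k - σ / p)))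
    (by fun_prop) (by fun_prop)
  have e1 : ∫⁻ t in Set.Ioc (0:ℝ) 1, ((fun t => ENNReal.ofReal (t ^ (σ / p)) * g t) * (fun t => ENNReal.ofReal (t ^ (k - σ / p)))) t
      = ∫⁻ t in Set.Ioc (0:ℝ) 1, ENNReal.ofReal (t ^ k) * g t := by
    apply setLIntegral_congr_fun measurableSet_Ioc
    intro t ht
    have ht0 := ht.1
    simp only [Pi.mul_apply]
    rw [mul_right_comm, ← ENNReal.ofReal_mul (by positivity), ← Real.rpow_add ht.1]
    simp
  have e2 : ∫⁻ t in Set.Ioc (0:ℝ) 1, (ENNReal.ofReal (t ^ (σ / p)) * g t) ^ p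
      = ∫⁻ t in Set.Ioc (0:ℝ) 1, ENNReal.ofReal (t ^ σ) * g t ^ p := by
    apply setLIntegral_congr_fun measurableSet_Ioc
    intro t ht
    have ht0 := ht.1
    simp only
    rw [ENNReal.mul_rpow_of_nonneg _ _ hp0.le, ENNReal.ofReal_rpow_of_nonneg (by positivity) hp0.le,
      ← Real.rpow_mul ht0.le, div_mul_cancel₀ _ hp0.ne']
  have e3 : ∫⁻ t in Set.Ioc (0:ℝ) 1, (ENNReal.ofReal (t ^ (k - σ / p))) ^ q
      = ∫⁻ t in Set.Ioc (0:ℝ) 1, ENNReal.ofReal (t ^ ((k - σ / p) * q)) := by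
    apply setLIntegral_congr_fun measurableSet_Ioc
    intro t ht
    have ht0 := ht.1
    simp only
    rw [ENNReal.ofReal_rpow_of_nonneg (by positivity) hq0.le, ← Real.rpow_mul ht0.le]
  rw [e1, e2, e3] at h
  refine (ENNReal.rpow_le_rpow h hp0.le).trans ?_
  rw [ENNReal.mul_rpow_of_nonneg _ _ hp0.le, ← ENNReal.rpow_mul, one_div_mul_cancel hp0.ne', ENNReal.rpow_one,
    mul_comm]

noncomputable def AA (U : (Fin d → ℝ) → ℝ≥0∞) (t : ℝ) (x : Fin d → ℝ) : ℝ≥0∞ :=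
  ∫⁻ y in Metric.closedBall (0 : Fin d → ℝ) (1 / (2 * d)), U (x + t • (jap x • y))

lemma AA_meas {U : (Fin d → ℝ) → ℝ≥0∞} (hU : Measurable U) :
    Measurable (fun q : ℝ × (Fin d → ℝ) => AA U q.1 q.2) := by
  unfold AA
  apply Measurable.lintegral_prod_right' (f := fun z : (ℝ × (Fin d → ℝ)) × (Fin d → ℝ) => U (z.1.2 + z.1.1 • (jap z.1.2 • z.2)))
  apply hU.comp
  have := (jap_cont (d := d))
  apply Continuous.measurable
  fun_prop

lemma avg_swap {B : Set (Fin d → ℝ)} {a D : ℝ≥0∞} (H : (Fin d → ℝ) → ℝ → ℝ≥0∞)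
    (hH : Measurable (fun z : (Fin d → ℝ) × ℝ => H z.1 z.2)) {w : ℝ → ℝ≥0∞} (hw : Measurable w) (hB : MeasurableSet B)
    (h : ∀ y ∈ B, a ≤ D * ∫⁻ t in Set.Ioc (0:ℝ) 1, w t * H y t) :
    a * volume B ≤ D * ∫⁻ t in Set.Ioc (0:ℝ) 1, w t * ∫⁻ y in B, H y t := by
  have hm : Measurable (fun z : (Fin d → ℝ) × ℝ => w z.2 * H z.1 z.2) :=
    Measurable.mul (by fun_prop) hH
  calc a * volume B = ∫⁻ y in B, a := by simp
    _ ≤ ∫⁻ y in B, D * ∫⁻ t in Set.Ioc (0:ℝ) 1, w t * H y t := setLIntegral_mono' hB h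
    _ = D * ∫⁻ y in B, ∫⁻ t in Set.Ioc (0:ℝ) 1, w t * H y t :=
        lintegral_const_mul _ (Measurable.lintegral_prod_right' hm)
    _ = D * ∫⁻ t in Set.Ioc (0:ℝ) 1, ∫⁻ y in B, w t * H y t := by
        rw [lintegral_lintegral_swap hm.aemeasurable]
    _ = _ := by
        congr 2; ext t
        rw [lintegral_const_mul]
        exact hH.comp (by fun_prop : Measurable fun y : Fin d → ℝ => (y, t))

lemma avg_GG (hd : 1 ≤ d) (e : ℝ) (k : ℕ) {p σ : ℝ} (hp : 1 < p) (hσ : σ < (k + 1) * p - 1) :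
    ∃ C : ℝ≥0∞, C ≠ ∞ ∧
    ∀ {u : (Fin d → ℝ) → ℝ} (_ : ContDiff ℝ (⊤ : ℕ∞) u) (x : Fin d → ℝ),
    g0 e u x ^ p ≤ C * ∫⁻ t in Set.Ioc (0:ℝ) 1, ENNReal.ofReal (t ^ σ) *
      AA (fun z => GG (k + 1) e u z ^ p) t x := by
  obtain ⟨C1, hC1, h1⟩ := point_GG hd e k
  obtain ⟨C2, hC2, h2⟩ := holder1 k hp hσ
  have hp0 : 0 < p := by linarith
  have hd' : (0 : ℝ) < d := by exact_mod_cast hd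
  set B := Metric.closedBall (0 : Fin d → ℝ) (1 / (2 * d)) with hB
  have hv0 : volume B ≠ 0 := (Metric.measure_closedBall_pos volume _ (by positivity)).ne'
  have hv1 : volume B ≠ ∞ := measure_closedBall_lt_top.ne
  refine ⟨(volume B)⁻¹ * (C1 ^ p * C2), ?_, ?_⟩
  · have := ENNReal.rpow_ne_top_of_nonneg hp0.le hC1
    have := ENNReal.inv_ne_top.2 hv0
    finiteness
  intro u hu x
  have hm := GG_meas (k+1) e hu
  have hy : ∀ y ∈ B, g0 e u x ^ p ≤ (C1 ^ p * C2) * ∫⁻ t in Set.Ioc (0:ℝ) 1, ENNReal.ofReal (t ^ σ) *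
      GG (k + 1) e u (x + t • (jap x • y)) ^ p := by
    intro y hy
    have hv : ‖jap x • y‖ ≤ jap x / (2 * d) := by
      rw [norm_smul, Real.norm_of_nonneg (jap_pos x).le, div_eq_mul_one_div]
      have := jap_pos x
      gcongr
      simpa [hB] using hy
    refine (ENNReal.rpow_le_rpow (h1 hu x _ hv) hp0.le).trans ?_
    rw [ENNReal.mul_rpow_of_nonneg _ _ hp0.le, mul_assoc]
    gcongr
    exact h2 _ (comp_meas hm x _)
  have hjm : Measurable (fun z : (Fin d → ℝ) × ℝ => GG (k + 1) e u (x + z.2 • (jap x • z.1)) ^ p) := by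
    apply Measurable.pow_const
    exact hm.comp (by fun_prop)
  have h3 := avg_swap (fun y t => GG (k + 1) e u (x + t • (jap x • y)) ^ p) hjm
    (w := fun t => ENNReal.ofReal (t ^ σ)) (by fun_prop) Metric.isClosed_closedBall.measurableSet hy
  calc g0 e u x ^ p = (volume B)⁻¹ * (g0 e u x ^ p * volume B) := by
          rw [mul_comm (g0 e u x ^ p), ← mul_assoc, ENNReal.inv_mul_cancel hv0 hv1, one_mul]
    _ ≤ (volume B)⁻¹ * ((C1 ^ p * C2) * ∫⁻ t in Set.Ioc (0:ℝ) 1, ENNReal.ofReal (t ^ σ) *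
      AA (fun z => GG (k + 1) e u z ^ p) t x) := mul_le_mul_right h3 _
    _ = _ := by rw [mul_assoc (volume B)⁻¹]

lemma hom_sub {F : (Fin d → ℝ) → ℝ≥0∞} (hF : Measurable F) (x : Fin d → ℝ) {r : ℝ} (hr : 0 < r) :
    ∫⁻ y, F (x + r • y) = ENNReal.ofReal ((r ^ d)⁻¹) * ∫⁻ z, F z := by
  have h1 : ∫⁻ y, F (x + r • y) = ∫⁻ y, (fun z => F (x + z)) y ∂(Measure.map (r • ·) (volume : Measure (Fin d → ℝ))) := by
    rw [lintegral_map (by fun_prop) (by fun_prop)]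
  rw [h1, Measure.map_addHaar_smul _ hr.ne', lintegral_smul_measure, lintegral_add_left_eq_self]
  simp [abs_of_pos hr]

lemma AA_le (U : (Fin d → ℝ) → ℝ≥0∞) (hU : Measurable U) (x : Fin d → ℝ) {t : ℝ} (ht : 0 < t) :
    ENNReal.ofReal (jap x ^ d) * AA U t x ≤ ENNReal.ofReal ((t ^ d)⁻¹) * ∫⁻ z, U z := by
  have hx := jap_pos x
  calc _ ≤ ENNReal.ofReal (jap x ^ d) * ∫⁻ y, U (x + (t * jap x) • y) := by
        gcongr
        unfold AA
        simp_rw [mul_smul]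
        exact setLIntegral_le_lintegral _ _
    _ = _ := by
        rw [hom_sub hU x (mul_pos ht hx), ← mul_assoc, ← ENNReal.ofReal_mul (by positivity)]
        congr 2
        rw [mul_pow]
        field_simp

lemma AA_int (hd : 1 ≤ d) : ∃ C : ℝ≥0∞, C ≠ ∞ ∧ ∀ (U : (Fin d → ℝ) → ℝ≥0∞) (_ : Measurable U)
    {t : ℝ} (_ : t ∈ Set.Ioc (0:ℝ) 1), ∫⁻ x, AA U t x ≤ C * ∫⁻ z, U z := by
  have hd' : (0 : ℝ) < d := by exact_mod_cast hd
  refine ⟨ENNReal.ofReal ((2 / d) ^ d) * volume (Metric.ball (0 : Fin d → ℝ) 1), ?_, ?_⟩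
  · have : volume (Metric.ball (0 : Fin d → ℝ) 1) ≠ ∞ := measure_ball_lt_top.ne
    finiteness
  intro U hU t ht
  have ht0 := ht.1
  have hj := (jap_cont (d := d))
  have hjm := hj.measurable
  set S : Set ((Fin d → ℝ) × (Fin d → ℝ)) := {q | dist q.1 q.2 ≤ t * jap q.2 / d} with hS
  have hSm : MeasurableSet S := measurableSet_le (by fun_prop) (by fun_prop)
  have hpt : ∀ x, AA U t x ≤ ∫⁻ z, S.indicator (fun q => ENNReal.ofReal (((t * jap q.2 / 2) ^ d)⁻¹) * U q.2) (x, z) := by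
    intro x
    have hx := jap_pos x
    set F : (Fin d → ℝ) → ℝ≥0∞ := (Metric.closedBall x (t * jap x / (2 * d))).indicator U with hF
    have hFm : Measurable F := hU.indicator Metric.isClosed_closedBall.measurableSet
    have e1 : AA U t x = ∫⁻ y, F (x + (t * jap x) • y) := by
      unfold AA
      rw [← lintegral_indicator Metric.isClosed_closedBall.measurableSet]
      congr 1; ext y
      have : y ∈ Metric.closedBall (0 : Fin d → ℝ) (1 / (2 * d)) ↔ x + (t * jap x) • y ∈ Metric.closedBall x (t * jap x / (2 * d)) := by
        simp only [Metric.mem_closedBall, dist_zero_right, dist_self_add_left, norm_smul,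
          Real.norm_of_nonneg (mul_pos ht0 hx).le]
        rw [div_eq_mul_one_div (t * jap x), mul_le_mul_iff_right₀ (mul_pos ht0 hx)]
      by_cases h : y ∈ Metric.closedBall (0 : Fin d → ℝ) (1 / (2 * d))
      · rw [Set.indicator_of_mem h, hF, Set.indicator_of_mem (this.1 h), mul_smul]
      · rw [Set.indicator_of_notMem h, hF, Set.indicator_of_notMem (fun h' => h (this.2 h'))]
    rw [e1, hom_sub hFm x (mul_pos ht0 hx), ← lintegral_const_mul _ hFm]
    apply lintegral_mono
    intro z
    by_cases h : z ∈ Metric.closedBall x (t * jap x / (2 * d))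
    · simp only [hF, Set.indicator_of_mem h]
      have hh : dist z x ≤ t * jap x / (2 * d) := h
      have hz := jap_pos z
      have hc := jap_comp hd x (z - x) (by
        rw [← dist_eq_norm]
        refine hh.trans ?_
        gcongr
        exact mul_le_of_le_one_left hx.le ht.2)
      rw [add_sub_cancel] at hc
      rw [Set.indicator_of_mem]
      · simp only
        gcongr
        have : t * jap z ≤ t * (2 * jap x) := by gcongr; exact hc.2
        linarith
      · simp only [hS, Set.mem_ofPred_eq]
        rw [dist_comm]
        refine hh.trans ?_
        rw [div_le_div_iff₀ (by positivity) (by positivity)]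
        have : t * jap x ≤ t * (2 * jap z) := by gcongr; exact hc.1
        nlinarith
    · simp only [hF, Set.indicator_of_notMem h]
      simp
  calc ∫⁻ x, AA U t x ≤ ∫⁻ x, ∫⁻ z, S.indicator (fun q => ENNReal.ofReal (((t * jap q.2 / 2) ^ d)⁻¹) * U q.2) (x, z) :=
        lintegral_mono hpt
    _ = ∫⁻ z, ∫⁻ x, S.indicator (fun q => ENNReal.ofReal (((t * jap q.2 / 2) ^ d)⁻¹) * U q.2) (x, z) := by
        rw [lintegral_lintegral_swap]
        apply Measurable.aemeasurable
        exact Measurable.indicator (by fun_prop) hSm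
    _ = ∫⁻ z, (ENNReal.ofReal ((2 / d) ^ d) * volume (Metric.ball (0 : Fin d → ℝ) 1)) * U z := by
        congr 1; ext z
        have hz := jap_pos z
        have e : ∀ x, S.indicator (fun q => ENNReal.ofReal (((t * jap q.2 / 2) ^ d)⁻¹) * U q.2) (x, z) =
            (Metric.closedBall z (t * jap z / d)).indicator (fun _ => ENNReal.ofReal (((t * jap z / 2) ^ d)⁻¹) * U z) x := by
          intro x; simp [Set.indicator, hS, Metric.mem_closedBall]
        simp_rw [e]
        rw [lintegral_indicator Metric.isClosed_closedBall.measurableSet, setLIntegral_const,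
          Measure.addHaar_closedBall _ _ (by positivity), mul_right_comm, ← mul_assoc, ← ENNReal.ofReal_mul (by positivity)]
        congr 3
        simp only [Module.finrank_fintype_fun_eq_card, Fintype.card_fin]
        rw [← inv_pow, ← mul_pow]
        congr 1
        field_simp
    _ = _ := lintegral_const_mul _ hU

lemma AA_bil_aux (hd : 1 ≤ d) : ∃ C : ℝ≥0∞, C ≠ ∞ ∧ ∀ (U V : (Fin d → ℝ) → ℝ≥0∞) (_ : Measurable U) (_ : Measurable V)
    {t s θ₁ θ₂ : ℝ} (_ : t ∈ Set.Ioc (0:ℝ) 1) (_ : s ∈ Set.Ioc (0:ℝ) 1) (_ : s ≤ t) (_ : 0 ≤ θ₂) (_ : θ₁ + θ₂ = d),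
    ∫⁻ x, ENNReal.ofReal (jap x ^ d) * (AA U t x * AA V s x) ≤
      C * (ENNReal.ofReal (t ^ (-θ₁)) * ENNReal.ofReal (s ^ (-θ₂)) * ((∫⁻ z, U z) * ∫⁻ z, V z)) := by
  obtain ⟨C, hC, h⟩ := AA_int hd
  refine ⟨C, hC, ?_⟩
  intro U V hU hV t s θ₁ θ₂ ht hs hst h2 hθ
  have ht0 := ht.1
  have hs0 := hs.1
  have hVm : Measurable (AA V s) := (AA_meas hV).comp (by fun_prop : Measurable fun x : Fin d → ℝ => (s, x))
  calc _ ≤ ∫⁻ x, (ENNReal.ofReal ((t ^ d)⁻¹) * ∫⁻ z, U z) * AA V s x := by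
        apply lintegral_mono
        intro x
        simp only
        rw [← mul_assoc]
        exact mul_le_mul_left (AA_le U hU x ht0) _
    _ = (ENNReal.ofReal ((t ^ d)⁻¹) * ∫⁻ z, U z) * ∫⁻ x, AA V s x := lintegral_const_mul _ hVm
    _ ≤ ((ENNReal.ofReal (t ^ (-θ₁)) * ENNReal.ofReal (s ^ (-θ₂))) * ∫⁻ z, U z) * (C * ∫⁻ z, V z) := by
        gcongr
        · rw [← ENNReal.ofReal_mul (by positivity)]
          apply ENNReal.ofReal_le_ofReal
          calc (t ^ d)⁻¹ = t ^ (-θ₁) * t ^ (-θ₂) := by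
                rw [← Real.rpow_add ht0, ← Real.rpow_natCast, ← Real.rpow_neg ht0.le]
                congr 1; linarith
            _ ≤ _ := by
                gcongr 1
                exact Real.rpow_le_rpow_of_nonpos hs0 hst (by linarith)
        · exact h V hV hs
    _ = _ := by ring

lemma AA_bil (hd : 1 ≤ d) : ∃ C : ℝ≥0∞, C ≠ ∞ ∧ ∀ (U V : (Fin d → ℝ) → ℝ≥0∞) (_ : Measurable U) (_ : Measurable V)
    {t s θ₁ θ₂ : ℝ} (_ : t ∈ Set.Ioc (0:ℝ) 1) (_ : s ∈ Set.Ioc (0:ℝ) 1) (_ : 0 ≤ θ₁) (_ : 0 ≤ θ₂) (_ : θ₁ + θ₂ = d),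
    ∫⁻ x, ENNReal.ofReal (jap x ^ d) * (AA U t x * AA V s x) ≤
      C * (ENNReal.ofReal (t ^ (-θ₁)) * ENNReal.ofReal (s ^ (-θ₂)) * ((∫⁻ z, U z) * ∫⁻ z, V z)) := by
  obtain ⟨C, hC, h⟩ := AA_bil_aux hd
  refine ⟨C, hC, ?_⟩
  intro U V hU hV t s θ₁ θ₂ ht hs h1 h2 hθ
  rcases le_total s t with hst | hst
  · exact h U V hU hV ht hs hst h2 hθ
  · have := h V U hV hU hs ht hst h1 ((add_comm _ _).trans hθ)
    simp_rw [mul_comm (AA V s _)] at this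
    refine this.trans (le_of_eq ?_)
    ring

lemma GG_zero (e : ℝ) (u : (Fin d → ℝ) → ℝ) (z : Fin d → ℝ) : GG 0 e u z = g0 e u z := rfl

lemma GG_succ (k : ℕ) (e : ℝ) (u : (Fin d → ℝ) → ℝ) (z : Fin d → ℝ) :
    GG (k + 1) e u z = g0 e u z + ∑ i, GG k (e + 1) (pd i u) z := rfl

attribute [local irreducible] AA
attribute [local irreducible] GG
attribute [local irreducible] g0

lemma meas_l {A : ℝ → (Fin d → ℝ) → ℝ≥0∞}
    (hA : Measurable (fun q : ℝ × (Fin d → ℝ) => A q.1 q.2)) (x : Fin d → ℝ) : Measurable (fun t => A t x) :=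
  hA.comp (by fun_prop : Measurable fun t : ℝ => (t, x))

lemma meas_r {A : ℝ → (Fin d → ℝ) → ℝ≥0∞}
    (hA : Measurable (fun q : ℝ × (Fin d → ℝ) => A q.1 q.2)) (t : ℝ) : Measurable (fun x => A t x) :=
  hA.comp (by fun_prop : Measurable fun x : Fin d → ℝ => (t, x))

lemma meas_int {A : ℝ → (Fin d → ℝ) → ℝ≥0∞}
    (hA : Measurable (fun q : ℝ × (Fin d → ℝ) => A q.1 q.2)) {w : ℝ → ℝ≥0∞} (hw : Measurable w) :
    Measurable (fun x => ∫⁻ t in Set.Ioc (0:ℝ) 1, w t * A t x) := by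
  have hm : Measurable (fun z : (Fin d → ℝ) × ℝ => A z.2 z.1) := hA.comp measurable_swap
  apply Measurable.lintegral_prod_right' (f := fun z : (Fin d → ℝ) × ℝ => w z.2 * A z.2 z.1)
  exact Measurable.mul (by fun_prop) hm

lemma swap_bound {N : (Fin d → ℝ) → ℝ≥0∞} (hN : Measurable N) {A : ℝ → (Fin d → ℝ) → ℝ≥0∞}
    (hA : Measurable (fun q : ℝ × (Fin d → ℝ) => A q.1 q.2)) {w r : ℝ → ℝ≥0∞} (hw : Measurable w)
    (hr : Measurable r) {K : ℝ≥0∞}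
    (h : ∀ t ∈ Set.Ioc (0:ℝ) 1, ∫⁻ x, N x * A t x ≤ K * r t) :
    ∫⁻ x, N x * ∫⁻ t in Set.Ioc (0:ℝ) 1, w t * A t x ≤ K * ∫⁻ t in Set.Ioc (0:ℝ) 1, w t * r t := by
  have hm : Measurable (fun z : (Fin d → ℝ) × ℝ => A z.2 z.1) := hA.comp measurable_swap
  have hm2 : Measurable (fun z : (Fin d → ℝ) × ℝ => N z.1 * (w z.2 * A z.2 z.1)) :=
    Measurable.mul (by fun_prop) (Measurable.mul (by fun_prop) hm)
  have hAx : ∀ x, Measurable (fun t => A t x) := fun x => hA.comp (by fun_prop : Measurable fun t : ℝ => (t, x))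
  have hAt : ∀ t, Measurable (fun x => A t x) := fun t => hA.comp (by fun_prop : Measurable fun x : Fin d → ℝ => (t, x))
  calc ∫⁻ x, N x * ∫⁻ t in Set.Ioc (0:ℝ) 1, w t * A t x
      = ∫⁻ x, ∫⁻ t in Set.Ioc (0:ℝ) 1, N x * (w t * A t x) := by
        congr 1; ext x
        have := hAx x
        rw [lintegral_const_mul _ (by fun_prop)]
    _ = ∫⁻ t in Set.Ioc (0:ℝ) 1, ∫⁻ x, N x * (w t * A t x) := lintegral_lintegral_swap hm2.aemeasurable
    _ = ∫⁻ t in Set.Ioc (0:ℝ) 1, w t * ∫⁻ x, N x * A t x := by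
        congr 1; ext t
        have := hAt t
        rw [← lintegral_const_mul _ (by fun_prop)]
        congr 1; ext x; ring
    _ ≤ ∫⁻ t in Set.Ioc (0:ℝ) 1, K * (w t * r t) := by
        apply setLIntegral_mono (by fun_prop)
        intro t ht
        calc _ ≤ w t * (K * r t) := mul_le_mul_right (h t ht) _
          _ = _ := by ring
    _ = _ := lintegral_const_mul _ (by fun_prop)

lemma wint {σ θ : ℝ} (h : θ < σ + 1) :
    ∫⁻ t in Set.Ioc (0:ℝ) 1, ENNReal.ofReal (t ^ σ) * ENNReal.ofReal (t ^ (-θ)) ≠ ∞ := by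
  have e : ∫⁻ t in Set.Ioc (0:ℝ) 1, ENNReal.ofReal (t ^ σ) * ENNReal.ofReal (t ^ (-θ)) =
      ∫⁻ t in Set.Ioc (0:ℝ) 1, ENNReal.ofReal (t ^ (σ - θ)) := by
    apply setLIntegral_congr_fun measurableSet_Ioc
    intro t ht
    have ht0 := ht.1
    simp only
    rw [← ENNReal.ofReal_mul (by positivity), ← Real.rpow_add ht0, sub_eq_add_neg]
  rw [e]
  exact rpow_fin (by linarith)

lemma bil_pos (hd : 1 ≤ d) (k₁ k₂ : ℕ) {p : ℝ} (hp : 1 < p) (e₁ e₂ : ℝ)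
    (h : (d : ℝ) < ((k₁ + 1 : ℝ) + (k₂ + 1)) * p) : ∃ C : ℝ≥0∞, C ≠ ∞ ∧
    ∀ {u v : (Fin d → ℝ) → ℝ} (_ : ContDiff ℝ (⊤ : ℕ∞) u) (_ : ContDiff ℝ (⊤ : ℕ∞) v),
    ∫⁻ x, ENNReal.ofReal (jap x ^ d) * (g0 e₁ u x ^ p * g0 e₂ v x ^ p) ≤
      C * ((∫⁻ z, GG (k₁ + 1) e₁ u z ^ p) * ∫⁻ z, GG (k₂ + 1) e₂ v z ^ p) := by
  have hp0 : 0 < p := by linarith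
  set n : ℝ := (k₁ + 1 : ℝ) + (k₂ + 1) with hn
  have hn0 : 0 < n := by positivity
  set θ₁ : ℝ := d * (k₁ + 1) / n
  set θ₂ : ℝ := d * (k₂ + 1) / n
  have hθ : θ₁ + θ₂ = d := by
    simp only [θ₁, θ₂]; field_simp; rw [hn]
  have hθ₁ : 0 ≤ θ₁ := by positivity
  have hθ₂ : 0 ≤ θ₂ := by positivity
  have hl₁ : θ₁ < (k₁ + 1) * p := by
    simp only [θ₁]; rw [div_lt_iff₀ hn0]
    have : (0:ℝ) < k₁ + 1 := by positivity
    nlinarith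
  have hl₂ : θ₂ < (k₂ + 1) * p := by
    simp only [θ₂]; rw [div_lt_iff₀ hn0]
    have : (0:ℝ) < k₂ + 1 := by positivity
    nlinarith
  obtain ⟨σ₁, ha₁, hb₁⟩ := exists_between hl₁
  obtain ⟨σ₂, ha₂, hb₂⟩ := exists_between hl₂
  obtain ⟨C₁, hC₁, h₁⟩ := avg_GG hd e₁ k₁ (σ := σ₁ - 1) hp (by linarith)
  obtain ⟨C₂, hC₂, h₂⟩ := avg_GG hd e₂ k₂ (σ := σ₂ - 1) hp (by linarith)
  obtain ⟨C₃, hC₃, h₃⟩ := AA_bil hd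
  have hi₁ := wint (σ := σ₁ - 1) (θ := θ₁) (by linarith)
  have hi₂ := wint (σ := σ₂ - 1) (θ := θ₂) (by linarith)
  set I₁ := ∫⁻ t in Set.Ioc (0:ℝ) 1, ENNReal.ofReal (t ^ (σ₁ - 1)) * ENNReal.ofReal (t ^ (-θ₁))
  set I₂ := ∫⁻ t in Set.Ioc (0:ℝ) 1, ENNReal.ofReal (t ^ (σ₂ - 1)) * ENNReal.ofReal (t ^ (-θ₂))
  refine ⟨C₁ * C₂ * (C₃ * I₁ * I₂), by finiteness, ?_⟩
  intro u v hu hv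
  set U : (Fin d → ℝ) → ℝ≥0∞ := fun z => GG (k₁ + 1) e₁ u z ^ p
  set V : (Fin d → ℝ) → ℝ≥0∞ := fun z => GG (k₂ + 1) e₂ v z ^ p
  have hU : Measurable U := (GG_meas _ _ hu).pow_const _
  have hV : Measurable V := (GG_meas _ _ hv).pow_const _
  have hAU := AA_meas hU
  have hAV := AA_meas hV
  have hj : Measurable (fun x : Fin d → ℝ => ENNReal.ofReal (jap x ^ d)) := by
    have := (jap_cont (d := d)).measurable
    fun_prop
  set Q := (∫⁻ z, U z) * ∫⁻ z, V z
  set F₁ : (Fin d → ℝ) → ℝ≥0∞ := fun x => ∫⁻ t in Set.Ioc (0:ℝ) 1, ENNReal.ofReal (t ^ (σ₁ - 1)) * AA U t x with hF₁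
  set F₂ : (Fin d → ℝ) → ℝ≥0∞ := fun x => ∫⁻ t in Set.Ioc (0:ℝ) 1, ENNReal.ofReal (t ^ (σ₂ - 1)) * AA V t x with hF₂
  have hF₂m : Measurable F₂ := meas_int (A := AA V) hAV (by fun_prop)
  have hF₁m : Measurable F₁ := meas_int (A := AA U) hAU (by fun_prop)
  have key : ∫⁻ x, (ENNReal.ofReal (jap x ^ d) * F₂ x) * F₁ x ≤ (C₃ * Q * I₂) * I₁ := by
    apply swap_bound (A := AA U) (hj.mul hF₂m) hAU (by fun_prop) (by fun_prop)
    intro t ht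
    have : ∫⁻ x, (ENNReal.ofReal (jap x ^ d) * AA U t x) * F₂ x ≤ (C₃ * Q * ENNReal.ofReal (t ^ (-θ₁))) * I₂ := by
      apply swap_bound (A := AA V) (hj.mul (meas_r (A := AA U) hAU t)) hAV (by fun_prop) (by fun_prop)
      intro s hs
      have := h₃ U V hU hV ht hs hθ₁ hθ₂ hθ
      simp only [Pi.mul_apply]
      simp_rw [mul_assoc]
      refine this.trans (le_of_eq ?_)
      simp only [Q]; ring
    calc _ = ∫⁻ x, (ENNReal.ofReal (jap x ^ d) * AA U t x) * F₂ x := by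
          congr 1; ext x; simp only [Pi.mul_apply]; ring
      _ ≤ _ := this
      _ = _ := by ring
  calc _ ≤ ∫⁻ x, (C₁ * C₂) * ((ENNReal.ofReal (jap x ^ d) * F₂ x) * F₁ x) := by
        apply lintegral_mono
        intro x
        calc _ ≤ ENNReal.ofReal (jap x ^ d) * ((C₁ * F₁ x) * (C₂ * F₂ x)) :=
              mul_le_mul_right (mul_le_mul' (h₁ hu x) (h₂ hv x)) _
          _ = _ := by ring
    _ = (C₁ * C₂) * ∫⁻ x, ((ENNReal.ofReal (jap x ^ d) * F₂ x) * F₁ x) :=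
        lintegral_const_mul _ ((hj.mul hF₂m).mul hF₁m)
    _ ≤ (C₁ * C₂) * ((C₃ * Q * I₂) * I₁) := mul_le_mul_right key _
    _ = _ := by ring

lemma bil_zero (hd : 1 ≤ d) (k₁ : ℕ) {p : ℝ} (hp : 1 < p) (e₁ e₂ : ℝ)
    (h : (d : ℝ) < (k₁ + 1 : ℝ) * p) : ∃ C : ℝ≥0∞, C ≠ ∞ ∧
    ∀ {u v : (Fin d → ℝ) → ℝ} (_ : ContDiff ℝ (⊤ : ℕ∞) u) (_ : ContDiff ℝ (⊤ : ℕ∞) v),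
    ∫⁻ x, ENNReal.ofReal (jap x ^ d) * (g0 e₁ u x ^ p * g0 e₂ v x ^ p) ≤
      C * ((∫⁻ z, GG (k₁ + 1) e₁ u z ^ p) * ∫⁻ z, GG 0 e₂ v z ^ p) := by
  obtain ⟨σ₁, ha₁, hb₁⟩ := exists_between h
  obtain ⟨C₁, hC₁, h₁⟩ := avg_GG hd e₁ k₁ (σ := σ₁ - 1) hp (by linarith)
  have hi₁ := wint (σ := σ₁ - 1) (θ := d) (by linarith)
  set I₁ := ∫⁻ t in Set.Ioc (0:ℝ) 1, ENNReal.ofReal (t ^ (σ₁ - 1)) * ENNReal.ofReal (t ^ (-(d:ℝ)))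
  refine ⟨C₁ * I₁, by finiteness, ?_⟩
  intro u v hu hv
  set U : (Fin d → ℝ) → ℝ≥0∞ := fun z => GG (k₁ + 1) e₁ u z ^ p
  have hU : Measurable U := (GG_meas _ _ hu).pow_const _
  have hg : Measurable fun x => g0 e₂ v x ^ p := (g0_meas _ hv).pow_const _
  have key : ∀ x, ENNReal.ofReal (jap x ^ d) * g0 e₁ u x ^ p ≤ C₁ * I₁ * ∫⁻ z, U z := by
    intro x
    have hAx : Measurable (fun t => AA U t x) :=
      meas_l (A := AA U) (AA_meas hU) x
    calc _ ≤ ENNReal.ofReal (jap x ^ d) * (C₁ * ∫⁻ t in Set.Ioc (0:ℝ) 1, ENNReal.ofReal (t ^ (σ₁ - 1)) * AA U t x) :=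
          mul_le_mul_right (h₁ hu x) _
      _ = C₁ * ∫⁻ t in Set.Ioc (0:ℝ) 1, ENNReal.ofReal (jap x ^ d) * (ENNReal.ofReal (t ^ (σ₁ - 1)) * AA U t x) := by
          rw [lintegral_const_mul _ (by fun_prop)]; ring
      _ ≤ C₁ * ∫⁻ t in Set.Ioc (0:ℝ) 1, (∫⁻ z, U z) * (ENNReal.ofReal (t ^ (σ₁ - 1)) * ENNReal.ofReal (t ^ (-(d:ℝ)))) := by
          refine mul_le_mul_right ?_ _
          apply setLIntegral_mono (by fun_prop)
          intro t ht
          have h2 := AA_le U hU x ht.1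
          rw [show (t ^ d)⁻¹ = t ^ (-(d:ℝ)) by rw [Real.rpow_neg ht.1.le, Real.rpow_natCast]] at h2
          calc _ = ENNReal.ofReal (t ^ (σ₁ - 1)) * (ENNReal.ofReal (jap x ^ d) * AA U t x) := by ring
            _ ≤ _ := mul_le_mul_right h2 _
            _ = _ := by ring
      _ = _ := by rw [lintegral_const_mul _ (by fun_prop)]; ring
  calc _ ≤ ∫⁻ x, (C₁ * I₁ * ∫⁻ z, U z) * g0 e₂ v x ^ p := by
        apply lintegral_mono
        intro x
        simp only
        rw [← mul_assoc]
        exact mul_le_mul_left (key x) _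
    _ = _ := by
        simp_rw [GG_zero]
        rw [lintegral_const_mul _ hg, mul_assoc]

lemma bil (hd : 1 ≤ d) (k₁ k₂ : ℕ) {p : ℝ} (hp : 1 < p) (e₁ e₂ : ℝ)
    (h : (d : ℝ) < ((k₁ : ℝ) + k₂) * p) : ∃ C : ℝ≥0∞, C ≠ ∞ ∧
    ∀ {u v : (Fin d → ℝ) → ℝ} (_ : ContDiff ℝ (⊤ : ℕ∞) u) (_ : ContDiff ℝ (⊤ : ℕ∞) v),
    ∫⁻ x, ENNReal.ofReal (jap x ^ d) * (g0 e₁ u x ^ p * g0 e₂ v x ^ p) ≤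
      C * ((∫⁻ z, GG k₁ e₁ u z ^ p) * ∫⁻ z, GG k₂ e₂ v z ^ p) := by
  rcases k₁ with _ | k₁ <;> rcases k₂ with _ | k₂
  · exfalso
    have : (0:ℝ) ≤ d := by positivity
    simp at h
    linarith
  · obtain ⟨C, hC, hh⟩ := bil_zero hd k₂ hp e₂ e₁ (by push_cast at h; linarith)
    refine ⟨C, hC, ?_⟩
    intro u v hu hv
    have := hh hv hu
    simp_rw [mul_comm (g0 e₁ _ _ ^ p)]
    refine this.trans (le_of_eq ?_)
    ring
  · exact bil_zero hd k₁ hp e₁ e₂ (by push_cast at h; linarith)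
  · exact bil_pos hd k₁ k₂ hp e₁ e₂ (by push_cast at h; linarith)

noncomputable def pdl (w : List (Fin d)) (f : (Fin d → ℝ) → ℝ) : (Fin d → ℝ) → ℝ := w.foldr pd f

def wordOf (α : Fin d → ℕ) : List (Fin d) := (List.finRange d).flatMap (fun j => List.replicate (α j) j)

lemma foldr_rep (n : ℕ) (j : Fin d) (f : (Fin d → ℝ) → ℝ) :
    (List.replicate n j).foldr pd f = (pd j)^[n] f := by
  induction n with
  | zero => rfl
  | succ n ih => rw [List.replicate_succ, List.foldr_cons, ih, Function.iterate_succ_apply']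

lemma pdm_eq (α : Fin d → ℕ) (f : (Fin d → ℝ) → ℝ) : pdm α f = pdl (wordOf α) f := by
  unfold pdm pdl wordOf
  induction (List.finRange d) with
  | nil => rfl
  | cons j L ih => rw [List.foldr_cons, ih, List.flatMap_cons, List.foldr_append, foldr_rep]

lemma wordOf_length (α : Fin d → ℕ) : (wordOf α).length = ∑ j, α j := by
  unfold wordOf
  rw [List.length_flatMap, Fin.sum_univ_def]
  simp

lemma wordOf_count (α : Fin d → ℕ) (i : Fin d) : (wordOf α).count i = α i := by
  unfold wordOf
  rw [List.count_flatMap]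
  have : (List.map (List.count i ∘ fun j => List.replicate (α j) j) (List.finRange d)).sum
      = ∑ j, if j = i then α j else 0 := by
    rw [Fin.sum_univ_def]
    congr 1
    apply List.map_congr_left
    intro j _
    simp [List.count_replicate]
  rw [this]
  simp

lemma pdl_smooth (w : List (Fin d)) {f : (Fin d → ℝ) → ℝ} (hf : ContDiff ℝ (⊤ : ℕ∞) f) :
    ContDiff ℝ (⊤ : ℕ∞) (pdl w f) := by
  induction w with
  | nil => exact hf
  | cons i w ih => exact pd_smooth i ih

lemma pd_cs (i : Fin d) {f : (Fin d → ℝ) → ℝ} (hf : HasCompactSupport f) : HasCompactSupport (pd i f) := by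
  unfold pd
  exact hf.fderiv_apply ℝ _

lemma pdl_cs (w : List (Fin d)) {f : (Fin d → ℝ) → ℝ} (hf : HasCompactSupport f) :
    HasCompactSupport (pdl w f) := by
  induction w with
  | nil => exact hf
  | cons i w ih => exact pd_cs i ih

lemma pd_comm (i j : Fin d) {u : (Fin d → ℝ) → ℝ} (hu : ContDiff ℝ (⊤ : ℕ∞) u) :
    pd i (pd j u) = pd j (pd i u) := by
  ext x
  have hs : IsSymmSndFDerivAt ℝ u x := by
    apply hu.contDiffAt.isSymmSndFDerivAt
    simp
    norm_cast
  have hd : DifferentiableAt ℝ (fderiv ℝ u) x :=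
    ((hu.fderiv_right (m := (⊤ : ℕ∞)) (by norm_cast)).differentiable (by norm_cast)) x
  have key : ∀ a b : Fin d, pd a (pd b u) x = fderiv ℝ (fderiv ℝ u) x (Pi.single a 1) (Pi.single b 1) := by
    intro a b
    unfold pd
    rw [fderiv_clm_apply hd (by fun_prop)]
    simp
  rw [key, key]
  exact hs _ _

lemma pdl_perm {w w' : List (Fin d)} (h : w.Perm w') {f : (Fin d → ℝ) → ℝ} (hf : ContDiff ℝ (⊤ : ℕ∞) f) :
    pdl w f = pdl w' f := by
  induction h with
  | nil => rfl
  | cons i _ ih => exact congrArg (pd i) ih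
  | swap i j l => exact pd_comm _ _ (pdl_smooth l hf)
  | trans _ _ h1 h2 => exact h1.trans h2

lemma pdl_snoc (w : List (Fin d)) (i : Fin d) (f : (Fin d → ℝ) → ℝ) : pdl (w ++ [i]) f = pdl w (pd i f) := by
  unfold pdl; simp

lemma pdl_add (w : List (Fin d)) {f g : (Fin d → ℝ) → ℝ} (hf : ContDiff ℝ (⊤ : ℕ∞) f) (hg : ContDiff ℝ (⊤ : ℕ∞) g) :
    pdl w (fun x => f x + g x) = fun x => pdl w f x + pdl w g x := by
  induction w with
  | nil => rfl
  | cons i w ih =>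
    change pd i (pdl w (fun x => f x + g x)) = fun x => pd i (pdl w f) x + pd i (pdl w g) x
    rw [ih]
    ext x
    unfold pd
    have h1 := ((pdl_smooth w hf).differentiable (by norm_cast)) x
    have h2 := ((pdl_smooth w hg).differentiable (by norm_cast)) x
    rw [fderiv_fun_add h1 h2]
    rfl

lemma pd_mul (i : Fin d) {f g : (Fin d → ℝ) → ℝ} (hf : ContDiff ℝ (⊤ : ℕ∞) f) (hg : ContDiff ℝ (⊤ : ℕ∞) g) :
    pd i (fun x => f x * g x) = fun x => pd i f x * g x + f x * pd i g x := by
  ext x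
  unfold pd
  have h1 := (hf.differentiable (by norm_cast)) x
  have h2 := (hg.differentiable (by norm_cast)) x
  rw [fderiv_fun_mul h1 h2]
  simp
  ring

lemma g0_pow (e : ℝ) (u : (Fin d → ℝ) → ℝ) {p : ℝ} (hp : 0 < p) (x : Fin d → ℝ) :
    g0 e u x ^ p = ENNReal.ofReal (jap x ^ (e * p) * |u x| ^ p) := by
  have hx := jap_pos x
  unfold g0
  rw [ENNReal.mul_rpow_of_nonneg _ _ hp.le, ENNReal.ofReal_mul (by positivity), Real.enorm_eq_ofReal_abs,
    ENNReal.ofReal_rpow_of_nonneg (by positivity) hp.le, ENNReal.ofReal_rpow_of_nonneg (by positivity) hp.le,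
    ← Real.rpow_mul hx.le]

lemma term_eq (e : ℝ) {u : (Fin d → ℝ) → ℝ} {p : ℝ} (hp : 0 < p) (hu : ContDiff ℝ (⊤ : ℕ∞) u)
    (hc : HasCompactSupport u) :
    ENNReal.ofReal (∫ x, jap x ^ (e * p) * |u x| ^ p) = ∫⁻ x, g0 e u x ^ p := by
  simp_rw [g0_pow e u hp]
  apply ofReal_integral_eq_lintegral_ofReal
  · apply Continuous.integrable_of_hasCompactSupport
    · apply Continuous.mul
      · exact jap_cont.rpow_const (fun x => Or.inl (jap_pos x).ne')
      · exact (hu.continuous.abs).rpow_const (fun x => Or.inr hp.le)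
    · apply HasCompactSupport.mul_left
      exact hc.comp_left (g := fun r : ℝ => |r| ^ p) (by simp [hp.ne'])
  · filter_upwards with x
    have hx := jap_pos x
    simp only [Pi.zero_apply]
    positivity

lemma term_nonneg (e : ℝ) (u : (Fin d → ℝ) → ℝ) (p : ℝ) : 0 ≤ ∫ x, jap x ^ (e * p) * |u x| ^ p := by
  apply integral_nonneg
  intro x
  have hx := jap_pos x
  simp only [Pi.zero_apply]
  positivity

lemma wnorm_nonneg (m : ℕ) (p δ : ℝ) (f : (Fin d → ℝ) → ℝ) : 0 ≤ wnorm d m p δ f := by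
  unfold wnorm
  apply Finset.sum_nonneg
  intro β _
  split_ifs
  · exact Real.rpow_nonneg (term_nonneg _ _ _) _
  · exact le_rfl

lemma wnorm_ge (m : ℕ) {p : ℝ} (hp : 0 < p) (δ : ℝ) (w : List (Fin d)) (hw : w.length ≤ m)
    {f : (Fin d → ℝ) → ℝ} (hf : ContDiff ℝ (⊤ : ℕ∞) f) (hc : HasCompactSupport f) :
    ∫⁻ x, g0 (δ + w.length) (pdl w f) x ^ p ≤ ENNReal.ofReal (wnorm d m p δ f) ^ p := by
  set α : Fin d → ℕ := fun j => w.count j with hα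
  have hperm : w.Perm (wordOf α) := by
    rw [List.perm_iff_count]
    intro i
    rw [wordOf_count]
  have hlen : ∑ j, α j = w.length := by
    rw [← wordOf_length]; exact hperm.length_eq.symm
  set β : Fin d → Fin (m + 1) := fun j => ⟨w.count j, Nat.lt_succ_of_le (List.count_le_length.trans hw)⟩ with hβ
  have hβα : (fun j => (β j : ℕ)) = α := rfl
  have h1 : (∫ x, jap x ^ ((δ + w.length) * p) * |pdl w f x| ^ p) ^ (1 / p) ≤ wnorm d m p δ f := by
    unfold wnorm
    have := Finset.single_le_sum (f := fun β : Fin d → Fin (m + 1) => if (∑ j, (β j : ℕ)) ≤ m then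
      (∫ x : Fin d → ℝ,
        jap x ^ ((δ + ((∑ j, (β j : ℕ)) : ℝ)) * p) *
          |pdm (fun j => (β j : ℕ)) f x| ^ p) ^ (1 / p)
    else 0) (s := Finset.univ) (fun β _ => by
        split_ifs
        · exact Real.rpow_nonneg (term_nonneg _ _ _) _
        · exact le_rfl) (Finset.mem_univ β)
    refine le_trans (le_of_eq ?_) this
    have hs : ∑ j, (β j : ℕ) = w.length := hlen
    have hs' : ∑ j, ((β j : ℕ) : ℝ) = w.length := by rw [← hs]; push_cast; rfl
    rw [if_pos (by rw [hs]; exact hw), hs', hβα, pdm_eq, ← pdl_perm hperm hf]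
  rw [← term_eq _ hp (pdl_smooth w hf) (pdl_cs w hc), ENNReal.ofReal_rpow_of_nonneg (wnorm_nonneg _ _ _ _) hp.le]
  apply ENNReal.ofReal_le_ofReal
  have h0 := term_nonneg (δ + w.length) (pdl w f) p
  calc _ = ((∫ x, jap x ^ ((δ + w.length) * p) * |pdl w f x| ^ p) ^ (1 / p)) ^ p := by
        rw [← Real.rpow_mul h0, one_div_mul_cancel hp.ne', Real.rpow_one]
    _ ≤ _ := Real.rpow_le_rpow (Real.rpow_nonneg h0 _) h1 hp.le

lemma GG_bound (m : ℕ) {p : ℝ} (hp : 1 < p) (δ : ℝ) (k : ℕ) : ∃ C : ℝ≥0∞, C ≠ ∞ ∧ ∀ (w : List (Fin d)) (_ : w.length + k ≤ m)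
    {f : (Fin d → ℝ) → ℝ} (_ : ContDiff ℝ (⊤ : ℕ∞) f) (_ : HasCompactSupport f),
    ∫⁻ x, GG k (δ + w.length) (pdl w f) x ^ p ≤ C * ENNReal.ofReal (wnorm d m p δ f) ^ p := by
  have hp0 : 0 < p := by linarith
  induction k with
  | zero =>
    refine ⟨1, by simp, ?_⟩
    intro w hw f hf hc
    simp_rw [GG_zero, one_mul]
    exact wnorm_ge m hp0 δ w hw hf hc
  | succ k ih =>
    obtain ⟨C, hC, h⟩ := ih
    set c2 : ℝ≥0∞ := 2 ^ (p - 1)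
    set cd : ℝ≥0∞ := ((Finset.univ : Finset (Fin d)).card : ℝ≥0∞) ^ (p - 1)
    have hc2 : c2 ≠ ∞ := ENNReal.rpow_ne_top_of_nonneg (by linarith) (by simp)
    have hcd : cd ≠ ∞ := ENNReal.rpow_ne_top_of_nonneg (by linarith) (by simp)
    refine ⟨c2 * (1 + cd * (d * C)), by finiteness, ?_⟩
    intro w hw f hf hc
    have hu := pdl_smooth w hf
    have hmg := g0_meas (δ + w.length) hu
    have hmG : ∀ i, Measurable (GG k (δ + w.length + 1) (pd i (pdl w f))) := fun i => GG_meas k _ (pd_smooth i hu)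
    have hi : ∀ i, ∫⁻ x, GG k (δ + w.length + 1) (pd i (pdl w f)) x ^ p ≤ C * ENNReal.ofReal (wnorm d m p δ f) ^ p := by
      intro i
      have := h (i :: w) (by simp; omega) hf hc
      rw [List.length_cons] at this
      push_cast at this
      rw [← add_assoc] at this
      exact this
    set W := ENNReal.ofReal (wnorm d m p δ f) ^ p
    calc _ ≤ ∫⁻ x, c2 * (g0 (δ + w.length) (pdl w f) x ^ p + cd * ∑ i, GG k (δ + w.length + 1) (pd i (pdl w f)) x ^ p) := by
          apply lintegral_mono
          intro x
          simp only
          rw [GG_succ]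
          refine (ENNReal.rpow_add_le_mul_rpow_add_rpow _ _ hp.le).trans ?_
          gcongr
          exact ENNReal.rpow_sum_le_const_mul_sum_rpow _ _ hp.le
      _ = c2 * ((∫⁻ x, g0 (δ + w.length) (pdl w f) x ^ p) + cd * ∑ i, ∫⁻ x, GG k (δ + w.length + 1) (pd i (pdl w f)) x ^ p) := by
          rw [lintegral_const_mul _ (by fun_prop), lintegral_add_left (by fun_prop), lintegral_const_mul _ (by fun_prop),
            lintegral_finsetSum _ (fun i _ => (hmG i).pow_const _)]
      _ ≤ c2 * (W + cd * ∑ i : Fin d, C * W) := by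
          gcongr
          · exact wnorm_ge m hp0 δ w (by omega) hf hc
          · exact hi _
      _ = _ := by
          simp
          ring

lemma base_prod {m : ℕ} (hd : 1 ≤ d) {p : ℝ} (hp : 1 < p) {δ : ℝ}
    (hm : (d : ℝ) / p < m) (hδ : 0 ≤ δ + (d : ℝ) / p) (w₁ w₂ : List (Fin d)) (hw : w₁.length + w₂.length ≤ m) :
    ∃ C : ℝ≥0∞, C ≠ ∞ ∧ ∀ {f g : (Fin d → ℝ) → ℝ} (_ : ContDiff ℝ (⊤ : ℕ∞) f) (_ : HasCompactSupport f)
      (_ : ContDiff ℝ (⊤ : ℕ∞) g) (_ : HasCompactSupport g),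
      ∫⁻ x, g0 (δ + (w₁.length + w₂.length)) (fun x => pdl w₁ f x * pdl w₂ g x) x ^ p ≤
        C * (ENNReal.ofReal (wnorm d m p δ f) ^ p * ENNReal.ofReal (wnorm d m p δ g) ^ p) := by
  have hp0 : 0 < p := by linarith
  obtain ⟨C₁, hC₁, h₁⟩ := GG_bound (d := d) m hp δ (m - w₁.length)
  obtain ⟨C₂, hC₂, h₂⟩ := GG_bound (d := d) m hp δ (m - w₂.length)
  obtain ⟨C, hC, h⟩ := bil hd (m - w₁.length) (m - w₂.length) hp (δ + w₁.length) (δ + w₂.length) (by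
    rw [div_lt_iff₀ hp0] at hm
    refine hm.trans_le ?_
    gcongr
    norm_cast
    omega)
  refine ⟨C * (C₁ * C₂), by finiteness, ?_⟩
  intro f g hf hfc hg hgc
  calc _ ≤ ∫⁻ x, ENNReal.ofReal (jap x ^ d) * (g0 (δ + w₁.length) (pdl w₁ f) x ^ p * g0 (δ + w₂.length) (pdl w₂ g) x ^ p) := by
        apply lintegral_mono
        intro x
        have hx := jap_pos x
        simp only
        rw [g0_pow _ _ hp0, g0_pow _ _ hp0, g0_pow _ _ hp0, ← ENNReal.ofReal_mul (by positivity), ← ENNReal.ofReal_mul (by positivity)]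
        apply ENNReal.ofReal_le_ofReal
        rw [abs_mul, Real.mul_rpow (abs_nonneg _) (abs_nonneg _)]
        have hj : jap x ^ ((δ + (w₁.length + w₂.length)) * p) ≤ jap x ^ d * (jap x ^ ((δ + w₁.length) * p) * jap x ^ ((δ + w₂.length) * p)) := by
          rw [← Real.rpow_natCast, ← Real.rpow_add hx, ← Real.rpow_add hx]
          apply Real.rpow_le_rpow_of_exponent_le (jap_ge_one x)
          have : 0 ≤ (δ + d / p) * p := by positivity
          rw [add_mul, div_mul_cancel₀ _ hp0.ne'] at this
          linarith
        calc _ ≤ (jap x ^ d * (jap x ^ ((δ + w₁.length) * p) * jap x ^ ((δ + w₂.length) * p))) * (|pdl w₁ f x| ^ p * |pdl w₂ g x| ^ p) := by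
              gcongr
          _ = _ := by ring
    _ ≤ _ := h (pdl_smooth w₁ hf) (pdl_smooth w₂ hg)
    _ ≤ C * ((C₁ * ENNReal.ofReal (wnorm d m p δ f) ^ p) * (C₂ * ENNReal.ofReal (wnorm d m p δ g) ^ p)) := by
        gcongr
        · exact h₁ w₁ (by omega) hf hfc
        · exact h₂ w₂ (by omega) hg hgc
    _ = _ := by ring

lemma leib {m : ℕ} (hd : 1 ≤ d) {p : ℝ} (hp : 1 < p) {δ : ℝ}
    (hm : (d : ℝ) / p < m) (hδ : 0 ≤ δ + (d : ℝ) / p) (n : ℕ) : ∀ (w w₁ w₂ : List (Fin d)) (_ : w.length = n)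
    (_ : w.length + (w₁.length + w₂.length) ≤ m),
    ∃ C : ℝ≥0∞, C ≠ ∞ ∧ ∀ {f g : (Fin d → ℝ) → ℝ} (_ : ContDiff ℝ (⊤ : ℕ∞) f) (_ : HasCompactSupport f)
      (_ : ContDiff ℝ (⊤ : ℕ∞) g) (_ : HasCompactSupport g),
      ∫⁻ x, g0 (δ + (w.length + (w₁.length + w₂.length))) (pdl w (fun x => pdl w₁ f x * pdl w₂ g x)) x ^ p ≤
        C * (ENNReal.ofReal (wnorm d m p δ f) ^ p * ENNReal.ofReal (wnorm d m p δ g) ^ p) := by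
  have hp0 : 0 < p := by linarith
  induction n with
  | zero =>
    intro w w₁ w₂ hn hw
    obtain rfl := List.length_eq_zero_iff.1 hn
    obtain ⟨C, hC, h⟩ := base_prod hd hp hm hδ w₁ w₂ (by simpa using hw)
    refine ⟨C, hC, ?_⟩
    intro f g hf hfc hg hgc
    simpa [pdl] using h hf hfc hg hgc
  | succ n ih =>
    intro w w₁ w₂ hn hw
    rcases List.eq_nil_or_concat w with rfl | ⟨w', i, rfl⟩
    · simp at hn
    rw [List.concat_eq_append] at *
    simp only [List.length_append, List.length_cons, List.length_nil] at hn hw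
    obtain ⟨C₁, hC₁, h₁⟩ := ih w' (i :: w₁) w₂ (by omega) (by simp; omega)
    obtain ⟨C₂, hC₂, h₂⟩ := ih w' w₁ (i :: w₂) (by omega) (by simp; omega)
    have hc2 : (2:ℝ≥0∞) ^ (p - 1) ≠ ∞ := ENNReal.rpow_ne_top_of_nonneg (by linarith) (by simp)
    refine ⟨2 ^ (p - 1) * (C₁ + C₂), by finiteness, ?_⟩
    intro f g hf hfc hg hgc
    have hs₁ := pdl_smooth w₁ hf
    have hs₂ := pdl_smooth w₂ hg
    have hs₁' : ContDiff ℝ (⊤ : ℕ∞) (fun x => pdl (i :: w₁) f x * pdl w₂ g x) := (pdl_smooth (i :: w₁) hf).mul hs₂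
    have hs₂' : ContDiff ℝ (⊤ : ℕ∞) (fun x => pdl w₁ f x * pdl (i :: w₂) g x) := hs₁.mul (pdl_smooth (i :: w₂) hg)
    have e1 : pdl (w' ++ [i]) (fun x => pdl w₁ f x * pdl w₂ g x) =
        fun x => pdl w' (fun x => pdl (i :: w₁) f x * pdl w₂ g x) x + pdl w' (fun x => pdl w₁ f x * pdl (i :: w₂) g x) x := by
      rw [pdl_snoc, pd_mul i hs₁ hs₂, ← pdl_add w' hs₁' hs₂']
      rfl
    have k₁ := h₁ hf hfc hg hgc
    have k₂ := h₂ hf hfc hg hgc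
    set E : ℝ := δ + (((w' ++ [i]).length : ℝ) + ((w₁.length : ℝ) + w₂.length)) with hE
    have E1 : δ + ((w'.length : ℝ) + (((i :: w₁).length : ℝ) + w₂.length)) = E := by
      rw [hE]; simp only [List.length_append, List.length_cons, List.length_nil]; push_cast; ring
    have E2 : δ + ((w'.length : ℝ) + ((w₁.length : ℝ) + (i :: w₂).length)) = E := by
      rw [hE]; simp only [List.length_append, List.length_cons, List.length_nil]; push_cast; ring
    rw [E1] at k₁
    rw [E2] at k₂
    rw [e1]
    have hm1 := g0_meas E (pdl_smooth w' hs₁')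
    have hm2 := g0_meas E (pdl_smooth w' hs₂')
    set u := pdl w' (fun x => pdl (i :: w₁) f x * pdl w₂ g x)
    set v := pdl w' (fun x => pdl w₁ f x * pdl (i :: w₂) g x)
    calc _ ≤ ∫⁻ x, 2 ^ (p - 1) * (g0 E u x ^ p + g0 E v x ^ p) := by
          apply lintegral_mono
          intro x
          refine le_trans ?_ (ENNReal.rpow_add_le_mul_rpow_add_rpow _ _ hp.le)
          apply ENNReal.rpow_le_rpow _ hp0.le
          unfold g0
          rw [← mul_add]
          gcongr
          exact enorm_add_le _ _
      _ = 2 ^ (p - 1) * ((∫⁻ x, g0 E u x ^ p) + ∫⁻ x, g0 E v x ^ p) := by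
          rw [lintegral_const_mul _ (by fun_prop), lintegral_add_left (by fun_prop)]
      _ ≤ 2 ^ (p - 1) * (C₁ * (ENNReal.ofReal (wnorm d m p δ f) ^ p * ENNReal.ofReal (wnorm d m p δ g) ^ p) + C₂ * (ENNReal.ofReal (wnorm d m p δ f) ^ p * ENNReal.ofReal (wnorm d m p δ g) ^ p)) :=
          mul_le_mul_right (add_le_add k₁ k₂) _
      _ = _ := by ring

end Helpers

theorem stmt2 (d m : ℕ) (hd : 1 ≤ d) (p : ℝ) (hp : 1 < p) (δ : ℝ)
    (hm : (d : ℝ) / p < m) (hδ : 0 ≤ δ + (d : ℝ) / p) :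
    ∃ C > 0, ∀ f g : (Fin d → ℝ) → ℝ,
      ContDiff ℝ (⊤ : ℕ∞) f → HasCompactSupport f → ContDiff ℝ (⊤ : ℕ∞) g → HasCompactSupport g →
        wnorm d m p δ (fun x => f x * g x) ≤ C * wnorm d m p δ f * wnorm d m p δ g := by
  have hp0 : 0 < p := by linarith
  have key : ∀ β : Fin d → Fin (m + 1), ∃ C : ℝ, 0 ≤ C ∧ ∀ f g : (Fin d → ℝ) → ℝ,
      ContDiff ℝ (⊤ : ℕ∞) f → HasCompactSupport f → ContDiff ℝ (⊤ : ℕ∞) g → HasCompactSupport g →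
      (if (∑ j, (β j : ℕ)) ≤ m then
      (∫ x : Fin d → ℝ,
        jap x ^ ((δ + ((∑ j, (β j : ℕ)) : ℝ)) * p) *
          |pdm (fun j => (β j : ℕ)) (fun x => f x * g x) x| ^ p) ^ (1 / p)
      else 0) ≤ C * (wnorm d m p δ f * wnorm d m p δ g) := by
    intro β
    by_cases hβ : (∑ j, (β j : ℕ)) ≤ m
    swap
    · refine ⟨0, le_rfl, ?_⟩
      intro f g _ _ _ _
      simp [hβ]
    set w := wordOf (fun j => (β j : ℕ)) with hw
    have hlen : w.length = ∑ j, (β j : ℕ) := wordOf_length _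
    obtain ⟨C, hC, h⟩ := leib hd hp hm hδ w.length w [] [] rfl (by simpa [hlen] using hβ)
    refine ⟨C.toReal ^ (1 / p), by positivity, ?_⟩
    intro f g hf hfc hg hgc
    have h1 := h hf hfc hg hgc
    have hfg : ContDiff ℝ (⊤ : ℕ∞) (fun x => f x * g x) := hf.mul hg
    have hfgc : HasCompactSupport (fun x => f x * g x) := hfc.mul_right
    have hF := wnorm_nonneg m p δ f
    have hG := wnorm_nonneg m p δ g
    have hcast : ∑ j, ((β j : ℕ) : ℝ) = w.length := by rw [hlen]; push_cast; rfl
    have e0 : pdl w (fun x => pdl [] f x * pdl [] g x) = pdl w (fun x => f x * g x) := rfl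
    rw [if_pos hβ, hcast, pdm_eq, ← hw]
    rw [e0] at h1
    simp only [List.length_nil, Nat.cast_zero, add_zero] at h1
    rw [← term_eq _ hp0 (pdl_smooth w hfg) (pdl_cs w hfgc), ENNReal.ofReal_rpow_of_nonneg hF hp0.le,
      ENNReal.ofReal_rpow_of_nonneg hG hp0.le, ← ENNReal.ofReal_mul (by positivity), ← ENNReal.ofReal_toReal hC,
      ← ENNReal.ofReal_mul (by positivity), ENNReal.ofReal_le_ofReal_iff (by positivity)] at h1
    refine (Real.rpow_le_rpow (term_nonneg _ _ _) h1 (by positivity)).trans (le_of_eq ?_)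
    rw [Real.mul_rpow (by positivity) (by positivity), ← Real.mul_rpow hF hG, ← Real.rpow_mul (by positivity),
      mul_one_div_cancel hp0.ne', Real.rpow_one]
  choose C hC0 hC using key
  refine ⟨1 + ∑ β, C β, ?_, ?_⟩
  · have : 0 ≤ ∑ β, C β := Finset.sum_nonneg fun β _ => hC0 β
    linarith
  intro f g hf hfc hg hgc
  have hF := wnorm_nonneg m p δ f
  have hG := wnorm_nonneg m p δ g
  calc wnorm d m p δ (fun x => f x * g x) ≤ ∑ β, C β * (wnorm d m p δ f * wnorm d m p δ g) := by
        conv_lhs => unfold wnorm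
        exact Finset.sum_le_sum fun β _ => hC β f g hf hfc hg hgc
    _ = (∑ β, C β) * (wnorm d m p δ f * wnorm d m p δ g) := by rw [Finset.sum_mul]
    _ ≤ _ := by
        rw [mul_assoc]
        gcongr
        linarith
end

section
/- Let d ≥ 2, ν > 0, T > 0, and let (u, 𝔭) and (v, 𝔮) be two smooth solutions on [0,T] × ℝ^d of the Navier–Stokes equations ∂_t u + (u·∇)u = νΔu − ∇𝔭 and ∂_t v + (v·∇)v = νΔv − ∇𝔮 with div u(t,·) = div v(t,·) = 0, such that u(0,·) = v(0,·), and such that for every multi-index α and every integer k ≥ 0 the quantities sup_{t ∈ [0,T], x ∈ ℝ^d} ⟨x⟩^k |∂_x^α u(t,x)| and sup_{t ∈ [0,T], x ∈ ℝ^d} ⟨x⟩^k |∂_x^α v(t,x)| are finite, and 𝔭(t,x) → 0 and 𝔮(t,x) → 0 as |x| → ∞ for each t. Then u = v on [0,T] × ℝ^d. -/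
open MeasureTheory

namespace NSU

open Set Filter Topology

/-- Smoothness abbreviation. -/
abbrev Sm {F : Type*} [NormedAddCommGroup F] [NormedSpace ℝ F] (f : F → ℝ) : Prop :=
  ContDiff ℝ (⊤ : ℕ∞) f

/-- Spatial partial derivative of a space-time function. -/
noncomputable def Dx {d : ℕ} (j : Fin d) (f : ℝ × (Fin d → ℝ) → ℝ) : ℝ × (Fin d → ℝ) → ℝ :=
  fun z => fderiv ℝ f z (0, Pi.single j 1)

/-- Time derivative of a space-time function. -/
noncomputable def Dt {d : ℕ} (f : ℝ × (Fin d → ℝ) → ℝ) : ℝ × (Fin d → ℝ) → ℝ :=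
  fun z => fderiv ℝ f z (1, 0)

variable {d : ℕ}

lemma Sm.Dx {f : ℝ × (Fin d → ℝ) → ℝ} (hf : Sm f) (j : Fin d) : Sm (Dx j f) := by
  have h : ContDiff ℝ (⊤ : ℕ∞) (fderiv ℝ f) := hf.fderiv_right (by simp)
  exact h.clm_apply contDiff_const

lemma Sm.Dt {f : ℝ × (Fin d → ℝ) → ℝ} (hf : Sm f) : Sm (Dt f) := by
  have h : ContDiff ℝ (⊤ : ℕ∞) (fderiv ℝ f) := hf.fderiv_right (by simp)
  exact h.clm_apply contDiff_const

lemma Sm.slice {f : ℝ × (Fin d → ℝ) → ℝ} (hf : Sm f) (t : ℝ) : Sm (fun x => f (t, x)) :=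
  hf.comp (contDiff_const.prodMk contDiff_id)

lemma hasF_slice {f : ℝ × (Fin d → ℝ) → ℝ} (hf : Sm f) (t : ℝ) (x : Fin d → ℝ) :
    HasFDerivAt (fun y => f (t, y))
      ((fderiv ℝ f (t, x)).comp (ContinuousLinearMap.inr ℝ ℝ (Fin d → ℝ))) x := by
  have h := (hf.differentiable (by simp) (t, x)).hasFDerivAt
  exact h.comp x (hasFDerivAt_prodMk_right t x)

lemma pd_slice {f : ℝ × (Fin d → ℝ) → ℝ} (hf : Sm f) (t : ℝ) (j : Fin d) :
    pd j (fun y => f (t, y)) = fun x => Dx j f (t, x) := by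
  funext x
  simp [pd, (hasF_slice hf t x).fderiv, Dx]

lemma fderiv_slice {f : ℝ × (Fin d → ℝ) → ℝ} (hf : Sm f) (t : ℝ) (j : Fin d) (x) :
    fderiv ℝ (fun y => f (t, y)) x (Pi.single j 1) = Dx j f (t, x) := by
  simp [(hasF_slice hf t x).fderiv, Dx]

lemma hasD_time {f : ℝ × (Fin d → ℝ) → ℝ} (hf : Sm f) (t : ℝ) (x : Fin d → ℝ) :
    HasDerivAt (fun s => f (s, x)) (Dt f (t, x)) t := by
  have h := (hf.differentiable (by simp) (t, x)).hasFDerivAt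
  have := h.comp t (hasFDerivAt_prodMk_left (𝕜 := ℝ) t x)
  have h2 := this.hasDerivAt
  simp only [ContinuousLinearMap.comp_apply, ContinuousLinearMap.inl_apply] at h2
  exact h2

lemma pdm_single (j : Fin d) (n : ℕ) (f : (Fin d → ℝ) → ℝ) :
    pdm (Pi.single j n) f = (pd j)^[n] f := by
  have key : ∀ l : List (Fin d), l.Nodup →
      l.foldr (fun i g => (pd i)^[(Pi.single j n : Fin d → ℕ) i] g) f =
        if j ∈ l then (pd j)^[n] f else f := by
    intro l
    induction l with
    | nil => intro _; simp
    | cons a l ih =>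
      intro hl
      rw [List.nodup_cons] at hl
      rw [List.foldr_cons, ih hl.2]
      by_cases h : a = j
      · subst h
        simp [hl.1]
      · simp [h, Ne.symm h]
  have := key _ (List.nodup_finRange d)
  simpa [pdm] using this

lemma jap_ge (x : Fin d → ℝ) : (1 + ‖x‖) / 2 ≤ jap x := by
  have h0 : 0 ≤ ∑ i, x i ^ 2 := Finset.sum_nonneg fun i _ => sq_nonneg _
  have h1 : 1 ≤ jap x := by
    unfold jap; rw [Real.one_le_sqrt]; linarith
  have h2 : ‖x‖ ≤ jap x := by
    rw [pi_norm_le_iff_of_nonneg (by linarith)]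
    intro i
    unfold jap
    rw [Real.norm_eq_abs]
    apply Real.abs_le_sqrt
    have := Finset.single_le_sum (f := fun i => x i ^ 2) (fun i _ => sq_nonneg _) (Finset.mem_univ i)
    linarith
  linarith

/-- Rapid decay, uniformly for times in `[0,T]`. -/
def Dec (T : ℝ) (f : ℝ × (Fin d → ℝ) → ℝ) : Prop :=
  ∀ k : ℕ, ∃ C : ℝ, 0 ≤ C ∧ ∀ t ∈ Icc (0 : ℝ) T, ∀ x, |f (t, x)| ≤ C * ((1 + ‖x‖) ^ k)⁻¹

variable {T : ℝ}

lemma dec_of_jap {f : ℝ × (Fin d → ℝ) → ℝ}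
    (h : ∀ k : ℕ, ∃ C : ℝ, ∀ t ∈ Icc (0 : ℝ) T, ∀ x, jap x ^ (k : ℝ) * |f (t, x)| ≤ C) :
    Dec T f := by
  intro k
  obtain ⟨C, hC⟩ := h k
  refine ⟨|C| * 2 ^ k, by positivity, fun t ht x => ?_⟩
  have h1 := hC t ht x
  rw [Real.rpow_natCast] at h1
  have h2 : ((1 + ‖x‖) / 2) ^ k ≤ jap x ^ k :=
    pow_le_pow_left₀ (by positivity) (jap_ge x) k
  have h3 : ((1 + ‖x‖) / 2) ^ k * |f (t, x)| ≤ |C| :=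
    (mul_le_mul_of_nonneg_right h2 (abs_nonneg _)).trans (h1.trans (le_abs_self _))
  rw [div_pow] at h3
  rw [← div_eq_mul_inv, le_div_iff₀ (by positivity)]
  have h4 : (0:ℝ) < 2 ^ k := by positivity
  calc |f (t, x)| * (1 + ‖x‖) ^ k
      = ((1 + ‖x‖) ^ k / 2 ^ k * |f (t, x)|) * 2 ^ k := by field_simp
    _ ≤ |C| * 2 ^ k := by gcongr

lemma Dec.add {f g : ℝ × (Fin d → ℝ) → ℝ} (hf : Dec T f) (hg : Dec T g) :
    Dec T (fun z => f z + g z) := by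
  intro k
  obtain ⟨C, hC0, hC⟩ := hf k
  obtain ⟨C', hC0', hC'⟩ := hg k
  refine ⟨C + C', by positivity, fun t ht x => ?_⟩
  rw [add_mul]
  exact (abs_add_le _ _).trans (add_le_add (hC t ht x) (hC' t ht x))

lemma Dec.const_mul {f : ℝ × (Fin d → ℝ) → ℝ} (hf : Dec T f) (c : ℝ) :
    Dec T (fun z => c * f z) := by
  intro k
  obtain ⟨C, hC0, hC⟩ := hf k
  refine ⟨|c| * C, by positivity, fun t ht x => ?_⟩
  rw [abs_mul, mul_assoc]
  exact mul_le_mul_of_nonneg_left (hC t ht x) (abs_nonneg _)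

lemma Dec.sub {f g : ℝ × (Fin d → ℝ) → ℝ} (hf : Dec T f) (hg : Dec T g) :
    Dec T (fun z => f z - g z) := by
  have := hf.add (hg.const_mul (-1))
  simpa [sub_eq_add_neg] using this

lemma Dec.bdd {f : ℝ × (Fin d → ℝ) → ℝ} (hf : Dec T f) :
    ∃ C : ℝ, 0 ≤ C ∧ ∀ t ∈ Icc (0 : ℝ) T, ∀ x, |f (t, x)| ≤ C := by
  simpa using hf 0

lemma Dec.mul {f g : ℝ × (Fin d → ℝ) → ℝ} (hf : Dec T f) (hg : Dec T g) :
    Dec T (fun z => f z * g z) := by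
  intro k
  obtain ⟨C, hC0, hC⟩ := hf.bdd
  obtain ⟨C', hC0', hC'⟩ := hg k
  refine ⟨C * C', by positivity, fun t ht x => ?_⟩
  rw [abs_mul, mul_assoc]
  exact mul_le_mul (hC t ht x) (hC' t ht x) (abs_nonneg _) hC0

lemma Dec.sum {ι : Type*} (s : Finset ι) {f : ι → ℝ × (Fin d → ℝ) → ℝ}
    (hf : ∀ i, Dec T (f i)) : Dec T (fun z => ∑ i ∈ s, f i z) := by
  classical
  induction s using Finset.induction_on with
  | empty => intro k; exact ⟨0, le_rfl, by simp⟩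
  | insert a s ha ih =>
    simp only [Finset.sum_insert ha]
    exact (hf a).add ih

/-- integrable weight -/
noncomputable def wt (d : ℕ) (x : Fin d → ℝ) : ℝ := ((1 + ‖x‖) ^ (d + 1))⁻¹

lemma wt_int : Integrable (wt d) := by
  have h := integrable_one_add_norm (E := Fin d → ℝ) (μ := volume) (r := ((d + 1 : ℕ) : ℝ))
    (by simp)
  refine h.congr (ae_of_all _ fun x => ?_)
  simp only [wt]
  rw [Real.rpow_neg (by positivity), Real.rpow_natCast]

lemma Dec.int {f : ℝ × (Fin d → ℝ) → ℝ} (hf : Dec T f) (hc : Continuous f) {t : ℝ}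
    (ht : t ∈ Icc (0 : ℝ) T) : Integrable (fun x => f (t, x)) := by
  obtain ⟨C, hC0, hC⟩ := hf (d + 1)
  refine (wt_int.const_mul C).mono' (by fun_prop) (ae_of_all _ fun x => ?_)
  exact hC t ht x

lemma Dec.cont {f : ℝ × (Fin d → ℝ) → ℝ} (hf : Dec T f) (hc : Continuous f) :
    ContinuousOn (fun t => ∫ x, f (t, x)) (Icc 0 T) := by
  obtain ⟨C, hC0, hC⟩ := hf (d + 1)
  refine continuousOn_of_dominated (bound := fun x => C * wt d x) (fun t _ => by fun_prop)
    (fun t ht => ae_of_all _ fun x => hC t ht x) (wt_int.const_mul C)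
    (ae_of_all _ fun x => by fun_prop)

/-- Integration by parts. -/
lemma ibp {f g : ℝ × (Fin d → ℝ) → ℝ} (hf : Sm f) (hg : Sm g) (df : Dec T f) (dg : Dec T g)
    (j : Fin d) (df' : Dec T (Dx j f)) (dg' : Dec T (Dx j g)) {t : ℝ} (ht : t ∈ Icc (0 : ℝ) T) :
    ∫ x, f (t, x) * Dx j g (t, x) = - ∫ x, Dx j f (t, x) * g (t, x) := by
  have h := integral_mul_fderiv_eq_neg_fderiv_mul_of_integrable (μ := volume)
    (f := fun x => f (t, x)) (g := fun x => g (t, x)) (v := (Pi.single j 1 : Fin d → ℝ))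
  simp only [fderiv_slice hf, fderiv_slice hg] at h
  exact h ((df'.mul dg).int ((hf.Dx j).continuous.mul hg.continuous) ht)
    ((df.mul dg').int (hf.continuous.mul (hg.Dx j).continuous) ht)
    ((df.mul dg).int (hf.continuous.mul hg.continuous) ht)
    (fun x _ => (hf.slice t).differentiable (by simp) x)
    (fun x _ => (hg.slice t).differentiable (by simp) x)

lemma Dx_mul {f g : ℝ × (Fin d → ℝ) → ℝ} (hf : Sm f) (hg : Sm g) (j : Fin d) :
    Dx j (fun z => f z * g z) = fun z => f z * Dx j g z + g z * Dx j f z := by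
  funext z
  simp [Dx, fderiv_fun_mul (hf.differentiable (by simp) z) (hg.differentiable (by simp) z)]

lemma Dx_sub {f g : ℝ × (Fin d → ℝ) → ℝ} (hf : Sm f) (hg : Sm g) (j : Fin d) :
    Dx j (fun z => f z - g z) = fun z => Dx j f z - Dx j g z := by
  funext z
  simp [Dx, fderiv_fun_sub (hf.differentiable (by simp) z) (hg.differentiable (by simp) z)]

lemma Dt_sub {f g : ℝ × (Fin d → ℝ) → ℝ} (hf : Sm f) (hg : Sm g) :
    Dt (fun z => f z - g z) = fun z => Dt f z - Dt g z := by
  funext z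
  simp [Dt, fderiv_fun_sub (hf.differentiable (by simp) z) (hg.differentiable (by simp) z)]

/-- Time-integrated pressure. -/
lemma hasF_timeint {p : ℝ × (Fin d → ℝ) → ℝ} (hp : Sm p) (a b : ℝ) (x : Fin d → ℝ) :
    HasFDerivAt (fun y => ∫ τ in a..b, p (τ, y))
      (∫ τ in a..b, (fderiv ℝ p (τ, x)).comp (ContinuousLinearMap.inr ℝ ℝ (Fin d → ℝ))) x := by
  have hpc := hp.continuous
  have hf : Continuous (fderiv ℝ p) := hp.continuous_fderiv (by simp)
  have hF : Continuous (fun z : ℝ × (Fin d → ℝ) =>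
      (fderiv ℝ p z).comp (ContinuousLinearMap.inr ℝ ℝ (Fin d → ℝ))) := by fun_prop
  obtain ⟨C, hC⟩ := ((isCompact_uIcc (a := a) (b := b)).prod
    (isCompact_closedBall x 1)).exists_bound_of_continuousOn hF.continuousOn
  refine intervalIntegral.hasFDerivAt_integral_of_dominated_of_fderiv_le
    (s := Metric.closedBall x 1) (bound := fun _ => C)
    (F := fun y τ => p (τ, y))
    (F' := fun y τ => (fderiv ℝ p (τ, y)).comp (ContinuousLinearMap.inr ℝ ℝ (Fin d → ℝ)))
    (Metric.closedBall_mem_nhds x one_pos)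
    (Eventually.of_forall fun y => by fun_prop)
    (Continuous.intervalIntegrable (by fun_prop) _ _)
    (Continuous.aestronglyMeasurable (by fun_prop))
    (ae_of_all _ fun τ hτ y hy => hC (τ, y) ⟨uIoc_subset_uIcc hτ, hy⟩)
    (by simp)
    (ae_of_all _ fun τ hτ y hy => hasF_slice hp τ y)

lemma fderiv_timeint {p : ℝ × (Fin d → ℝ) → ℝ} (hp : Sm p) (a b : ℝ) (x : Fin d → ℝ)
    (q : Fin d) :
    fderiv ℝ (fun y => ∫ τ in a..b, p (τ, y)) x (Pi.single q 1) =
      ∫ τ in a..b, Dx q p (τ, x) := by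
  have hf : Continuous (fderiv ℝ p) := hp.continuous_fderiv (by simp)
  rw [(hasF_timeint hp a b x).fderiv, ContinuousLinearMap.intervalIntegral_apply]
  · simp [Dx]
  · exact Continuous.intervalIntegrable (by fun_prop) _ _

lemma clm_norm_le (A : (Fin d → ℝ) →L[ℝ] ℝ) (C : ℝ) (hC : 0 ≤ C)
    (h : ∀ q, |A (Pi.single q 1)| ≤ C) : ‖A‖ ≤ d * C := by
  refine A.opNorm_le_bound (by positivity) fun x => ?_
  have hx : A x = ∑ q, x q * A (Pi.single q 1) := by
    conv_lhs => rw [pi_eq_sum_univ' x]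
    simp [map_sum]
  rw [hx]
  calc ‖∑ q, x q * A (Pi.single q 1)‖ ≤ ∑ q : Fin d, ‖x‖ * C := by
        refine norm_sum_le_of_le _ fun q _ => ?_
        rw [norm_mul]
        exact mul_le_mul (norm_le_pi_norm x q) (h q) (norm_nonneg _) (norm_nonneg _)
    _ = d * C * ‖x‖ := by simp; ring

lemma Dec.int_lin {g : ℝ × (Fin d → ℝ) → ℝ} (hg : Dec T g) (hc : Continuous g) {t : ℝ}
    (ht : t ∈ Icc (0 : ℝ) T) {h : (Fin d → ℝ) → ℝ} (hh : Continuous h) (K : ℝ)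
    (hK : ∀ x, |h x| ≤ K * (1 + ‖x‖)) : Integrable (fun x => g (t, x) * h x) := by
  obtain ⟨C, hC0, hC⟩ := hg (d + 2)
  refine (wt_int.const_mul (C * K)).mono' (by fun_prop) (ae_of_all _ fun x => ?_)
  rw [Real.norm_eq_abs, abs_mul]
  have h1 : (0:ℝ) < 1 + ‖x‖ := by positivity
  calc |g (t, x)| * |h x| ≤ (C * ((1 + ‖x‖) ^ (d + 2))⁻¹) * (K * (1 + ‖x‖)) :=
        mul_le_mul (hC t ht x) (hK x) (abs_nonneg _) (by positivity)
    _ = C * K * wt d x := by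
        unfold wt; field_simp; ring

lemma press {Φ : (Fin d → ℝ) → ℝ} (hΦ : Differentiable ℝ Φ)
    (hc : ∀ q : Fin d, Continuous fun x => fderiv ℝ Φ x (Pi.single q 1)) (C : ℝ) (hC : 0 ≤ C)
    (hb : ∀ (q : Fin d) x, |fderiv ℝ Φ x (Pi.single q 1)| ≤ C)
    {w : Fin d → ℝ × (Fin d → ℝ) → ℝ} (hw : ∀ q, Sm (w q)) (dw : ∀ q, Dec T (w q))
    (dw' : ∀ q, Dec T (Dx q (w q))) {t : ℝ} (ht : t ∈ Icc (0 : ℝ) T)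
    (hdiv : ∀ x, ∑ q, Dx q (w q) (t, x) = 0) :
    (∀ q, Integrable (fun x => w q (t, x) * fderiv ℝ Φ x (Pi.single q 1))) ∧
    ∑ q, ∫ x, w q (t, x) * fderiv ℝ Φ x (Pi.single q 1) = 0 := by
  have hlip : ∀ x, |Φ x| ≤ (|Φ 0| + d * C) * (1 + ‖x‖) := by
    intro x
    have h1 := (convex_univ).norm_image_sub_le_of_norm_fderiv_le (𝕜 := ℝ) (f := Φ) (C := d * C)
      (fun y _ => hΦ y) (fun y _ => clm_norm_le _ C hC fun q => hb q y) (mem_univ 0) (mem_univ x)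
    rw [sub_zero, Real.norm_eq_abs] at h1
    have h2 : |Φ x| ≤ |Φ 0| + |Φ x - Φ 0| := by
      have := abs_add_le (Φ 0) (Φ x - Φ 0)
      simpa using this
    have h3 : 0 ≤ |Φ 0| * ‖x‖ := by positivity
    have h4 : 0 ≤ d * C := by positivity
    nlinarith [norm_nonneg x]
  have i1 : ∀ q, Integrable (fun x => w q (t, x) * fderiv ℝ Φ x (Pi.single q 1)) := by
    intro q
    refine (dw q).int_lin (hw q).continuous ht (hc q) C fun x => ?_
    have := hb q x
    nlinarith [norm_nonneg x]
  have i2 : ∀ q, Integrable (fun x => Dx q (w q) (t, x) * Φ x) := fun q =>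
    (dw' q).int_lin ((hw q).Dx q).continuous ht hΦ.continuous _ hlip
  refine ⟨i1, ?_⟩
  have h : ∀ q, ∫ x, w q (t, x) * fderiv ℝ Φ x (Pi.single q 1) =
      - ∫ x, Dx q (w q) (t, x) * Φ x := by
    intro q
    have h := integral_mul_fderiv_eq_neg_fderiv_mul_of_integrable (μ := volume)
      (f := fun x => w q (t, x)) (g := Φ) (v := (Pi.single q 1 : Fin d → ℝ))
    simp only [fderiv_slice (hw q)] at h
    exact h (i2 q) (i1 q)
      ((dw q).int_lin (hw q).continuous ht hΦ.continuous _ hlip)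
      (fun x _ => ((hw q).slice t).differentiable (by simp) x) (fun x _ => hΦ x)
  simp only [h]
  rw [Finset.sum_neg_distrib, ← integral_finsetSum _ fun q _ => i2 q]
  simp [← Finset.sum_mul, hdiv]

/-- the energy -/
noncomputable def En (w : Fin d → ℝ × (Fin d → ℝ) → ℝ) (t : ℝ) : ℝ :=
  ∫ x, ∑ q, w q (t, x) * w q (t, x)

lemma timeint_bd {G : ℝ × (Fin d → ℝ) → ℝ} {C : ℝ}
    (hC : ∀ t ∈ Icc (0 : ℝ) T, ∀ x, |G (t, x)| ≤ C) {t s : ℝ} (ht : t ∈ Icc (0 : ℝ) T)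
    (hs : s ∈ Icc (0 : ℝ) T) (x : Fin d → ℝ) : |∫ τ in t..s, G (τ, x)| ≤ C * |s - t| := by
  have := intervalIntegral.norm_integral_le_of_norm_le_const (a := t) (b := s) (C := C)
    (f := fun τ => G (τ, x)) (fun τ hτ => ?_)
  · simpa using this
  · exact hC τ ((uIoc_subset_uIcc.trans (uIcc_subset_Icc ht hs)) hτ) x

lemma timeint_cont {G : ℝ × (Fin d → ℝ) → ℝ} (hG : Continuous G) (t s : ℝ) :
    Continuous fun x => ∫ τ in t..s, G (τ, x) :=
  intervalIntegral.continuous_parametric_intervalIntegral_of_continuous'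
    (f := fun x τ => G (τ, x)) (by fun_prop) t s

lemma energy_diff {w G : Fin d → ℝ × (Fin d → ℝ) → ℝ} {p : ℝ × (Fin d → ℝ) → ℝ}
    (hw : ∀ q, Sm (w q)) (dw : ∀ q, Dec T (w q)) (dw' : ∀ q, Dec T (Dx q (w q)))
    (hG : ∀ q, Continuous (G q)) (dG : ∀ q, Dec T (G q)) (hp : Sm p)
    (hdiv : ∀ t ∈ Icc (0 : ℝ) T, ∀ x, ∑ q, Dx q (w q) (t, x) = 0)
    (heq : ∀ t ∈ Icc (0 : ℝ) T, ∀ x q, Dt (w q) (t, x) = G q (t, x) - Dx q p (t, x))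
    {t s : ℝ} (ht : t ∈ Icc (0 : ℝ) T) (hs : s ∈ Icc (0 : ℝ) T) :
    En w s - En w t =
      ∫ x, ∑ q, (∫ τ in t..s, G q (τ, x)) * (w q (s, x) + w q (t, x)) := by
  set Φ : (Fin d → ℝ) → ℝ := fun y => ∫ τ in t..s, p (τ, y) with hΦdef
  have hΦ : Differentiable ℝ Φ := fun x => (hasF_timeint hp t s x).differentiableAt
  have hF : ∀ (q : Fin d) x, fderiv ℝ Φ x (Pi.single q 1) = ∫ τ in t..s, Dx q p (τ, x) :=
    fun q x => fderiv_timeint hp t s x q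
  have ftc : ∀ (q : Fin d) x, w q (s, x) - w q (t, x) =
      (∫ τ in t..s, G q (τ, x)) - fderiv ℝ Φ x (Pi.single q 1) := by
    intro q x
    have cG := hG q
    have cp := (hp.Dx q).continuous
    have cw := (hw q).Dt.continuous
    rw [hF, ← intervalIntegral.integral_sub
      (Continuous.intervalIntegrable (by fun_prop) _ _)
      (Continuous.intervalIntegrable (by fun_prop) _ _),
      ← intervalIntegral.integral_eq_sub_of_hasDerivAt
        (f := fun τ => w q (τ, x)) (f' := fun τ => Dt (w q) (τ, x))
        (fun τ _ => hasD_time (hw q) τ x) (Continuous.intervalIntegrable (by fun_prop) _ _)]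
    exact intervalIntegral.integral_congr fun τ hτ => heq τ (uIcc_subset_Icc ht hs hτ) x q
  have hc : ∀ q : Fin d, Continuous fun x => fderiv ℝ Φ x (Pi.single q 1) := by
    intro q
    simp only [hF]
    exact timeint_cont (hp.Dx q).continuous t s
  choose A hA0 hA using fun q => (dG q).bdd
  choose B hB0 hB using fun q => (dw q).bdd
  have hb' : ∀ (q : Fin d) x, |fderiv ℝ Φ x (Pi.single q 1)| ≤ A q * |s - t| + B q + B q := by
    intro q x
    have h1 := ftc q x
    have h2 := abs_le.1 (hB q t ht x)
    have h3 := abs_le.1 (hB q s hs x)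
    have h4 := abs_le.1 (timeint_bd (hA q) ht hs x)
    rw [abs_le]
    constructor <;> linarith
  have hnn : ∀ q : Fin d, 0 ≤ A q * |s - t| + B q + B q := fun q => by
    have := hA0 q
    have := hB0 q
    positivity
  have hb : ∀ (q : Fin d) x, |fderiv ℝ Φ x (Pi.single q 1)| ≤
      ∑ q : Fin d, (A q * |s - t| + B q + B q) := fun q x =>
    (hb' q x).trans (Finset.single_le_sum (f := fun q => A q * |s - t| + B q + B q)
      (fun i _ => hnn i) (Finset.mem_univ q))
  have hs0 : 0 ≤ ∑ q : Fin d, (A q * |s - t| + B q + B q) :=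
    Finset.sum_nonneg fun q _ => hnn q
  obtain ⟨js, zs⟩ := press hΦ hc _ hs0 hb hw dw dw' hs (hdiv s hs)
  obtain ⟨jt, zt⟩ := press hΦ hc _ hs0 hb hw dw dw' ht (hdiv t ht)
  have isq : ∀ r ∈ Icc (0:ℝ) T, Integrable fun x => ∑ q, w q (r, x) * w q (r, x) := fun r hr =>
    integrable_finsetSum _ fun q _ =>
      ((dw q).mul (dw q)).int ((hw q).continuous.mul (hw q).continuous) hr
  have key : ∀ x, (∑ q, (∫ τ in t..s, G q (τ, x)) * (w q (s, x) + w q (t, x))) =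
      ((∑ q, w q (s, x) * w q (s, x)) - ∑ q, w q (t, x) * w q (t, x)) +
      ((∑ q, w q (s, x) * fderiv ℝ Φ x (Pi.single q 1)) +
       ∑ q, w q (t, x) * fderiv ℝ Φ x (Pi.single q 1)) := by
    intro x
    rw [← Finset.sum_sub_distrib, ← Finset.sum_add_distrib, ← Finset.sum_add_distrib]
    refine Finset.sum_congr rfl fun q _ => ?_
    have : (∫ τ in t..s, G q (τ, x)) =
      w q (s, x) - w q (t, x) + fderiv ℝ Φ x (Pi.single q 1) := by rw [ftc]; ring
    rw [this]; ring
  simp only [key]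
  have Js := integrable_finsetSum Finset.univ fun q _ => js q
  have Jt := integrable_finsetSum Finset.univ fun q _ => jt q
  have I1 : Integrable fun x => (∑ q, w q (s, x) * w q (s, x)) - ∑ q, w q (t, x) * w q (t, x) :=
    (isq s hs).sub (isq t ht)
  have I2 : Integrable fun x => (∑ q, w q (s, x) * fderiv ℝ Φ x (Pi.single q 1)) +
       ∑ q, w q (t, x) * fderiv ℝ Φ x (Pi.single q 1) := Js.add Jt
  rw [integral_add I1 I2, integral_sub (isq s hs) (isq t ht), integral_add Js Jt,
    integral_finsetSum _ fun q _ => js q, integral_finsetSum _ fun q _ => jt q, zs, zt]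
  simp [En]

lemma energy_slope {w G : Fin d → ℝ × (Fin d → ℝ) → ℝ} {p : ℝ × (Fin d → ℝ) → ℝ}
    (hw : ∀ q, Sm (w q)) (dw : ∀ q, Dec T (w q)) (dw' : ∀ q, Dec T (Dx q (w q)))
    (hG : ∀ q, Continuous (G q)) (dG : ∀ q, Dec T (G q)) (hp : Sm p)
    (hdiv : ∀ t ∈ Icc (0 : ℝ) T, ∀ x, ∑ q, Dx q (w q) (t, x) = 0)
    (heq : ∀ t ∈ Icc (0 : ℝ) T, ∀ x q, Dt (w q) (t, x) = G q (t, x) - Dx q p (t, x))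
    {t : ℝ} (ht : t ∈ Ico (0 : ℝ) T) :
    Tendsto (fun s => (s - t)⁻¹ * (En w s - En w t)) (𝓝[>] t)
      (𝓝 (∫ x, ∑ q, G q (t, x) * (w q (t, x) + w q (t, x)))) := by
  have ht' : t ∈ Icc (0 : ℝ) T := Ico_subset_Icc_self ht
  have hev : ∀ᶠ s in 𝓝[>] t, s ∈ Ioc t T := Ioc_mem_nhdsGT ht.2
  have hI : ∀ s ∈ Ioc t T, s ∈ Icc (0:ℝ) T := fun s hs => ⟨ht.1.trans hs.1.le, hs.2⟩
  have h1 : (fun s => ∫ x, ∑ q, ((s - t)⁻¹ * ∫ τ in t..s, G q (τ, x)) *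
      (w q (s, x) + w q (t, x))) =ᶠ[𝓝[>] t] fun s => (s - t)⁻¹ * (En w s - En w t) := by
    filter_upwards [hev] with s hs
    rw [energy_diff hw dw dw' hG dG hp hdiv heq ht' (hI s hs), ← integral_const_mul]
    simp only [Finset.mul_sum, mul_assoc]
  refine Tendsto.congr' h1 ?_
  choose A hA0 hA using fun q => (dG q).bdd
  choose B hB0 hB using fun q => dw q (d + 1)
  refine tendsto_integral_filter_of_dominated_convergence
    (fun x => (∑ q, A q * (B q + B q)) * wt d x) ?_ ?_ (wt_int.const_mul _) ?_
  · filter_upwards with s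
    refine Continuous.aestronglyMeasurable ?_
    refine continuous_finsetSum _ fun q _ => ?_
    have := timeint_cont (hG q) t s
    have := (hw q).continuous
    fun_prop
  · filter_upwards [hev] with s hs
    refine ae_of_all _ fun x => ?_
    rw [Finset.sum_mul]
    refine norm_sum_le_of_le _ fun q _ => ?_
    rw [norm_mul, mul_assoc]
    have hst : 0 < s - t := sub_pos.2 hs.1
    refine mul_le_mul ?_ ?_ (norm_nonneg _) (hA0 q)
    · have := timeint_bd (hA q) ht' (hI s hs) x
      rw [Real.norm_eq_abs, abs_mul, abs_inv, inv_mul_le_iff₀ (abs_pos.2 hst.ne')]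
      linarith
    · rw [add_mul]
      exact (norm_add_le _ _).trans (add_le_add (hB q s (hI s hs) x) (hB q t ht' x))
  · refine ae_of_all _ fun x => ?_
    refine tendsto_finsetSum _ fun q _ => ?_
    have cG : Continuous fun τ => G q (τ, x) := by have := hG q; fun_prop
    have cw : Continuous fun s => w q (s, x) := by have := (hw q).continuous; fun_prop
    refine Tendsto.mul ?_ ((cw.continuousAt.tendsto.mono_left nhdsWithin_le_nhds).add
      tendsto_const_nhds)
    have hd : HasDerivAt (fun s => ∫ τ in t..s, G q (τ, x)) (G q (t, x)) t :=
      intervalIntegral.integral_hasDerivAt_right (cG.intervalIntegrable _ _)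
        cG.stronglyMeasurable.stronglyMeasurableAtFilter cG.continuousAt
    have h2 := (hasDerivAt_iff_tendsto_slope.1 hd).mono_left
      (nhdsGT_le_nhdsNE t)
    simpa [slope_fun_def] using h2

lemma energy_ineq {u w v : Fin d → ℝ × (Fin d → ℝ) → ℝ} {ν M : ℝ} (hν : 0 < ν)
    (hu : ∀ q, Sm (u q)) (hw : ∀ q, Sm (w q)) (hv : ∀ q, Sm (v q))
    (du : ∀ q, Dec T (u q)) (dw : ∀ q, Dec T (w q))
    (du1 : ∀ j q, Dec T (Dx j (u q))) (dw1 : ∀ j q, Dec T (Dx j (w q)))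
    (dv1 : ∀ j q, Dec T (Dx j (v q)))
    (dw2 : ∀ j q, Dec T (Dx j (Dx j (w q)))) {t : ℝ} (ht : t ∈ Icc (0 : ℝ) T)
    (hdiv : ∀ x, ∑ q, Dx q (u q) (t, x) = 0)
    (hM : ∀ j q x, |Dx j (v q) (t, x)| ≤ M) :
    ∫ x, ∑ q, (ν * (∑ j, Dx j (Dx j (w q)) (t, x)) -
      ∑ j, (u j (t, x) * Dx j (w q) (t, x) + w j (t, x) * Dx j (v q) (t, x))) *
        (w q (t, x) + w q (t, x)) ≤ (2 * d * M) * En w t := by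
  have cw := fun q => (hw q).continuous
  have cu := fun q => (hu q).continuous
  have hww : ∀ q, Sm (fun z => w q z * w q z) := fun q => (hw q).mul (hw q)
  have dww : ∀ j q, Dec T (Dx j (fun z => w q z * w q z)) := fun j q => by
    rw [Dx_mul (hw q) (hw q)]
    exact ((dw q).mul (dw1 j q)).add ((dw q).mul (dw1 j q))
  have ia : ∀ q j, Integrable fun x => w q (t, x) * Dx j (Dx j (w q)) (t, x) := fun q j =>
    ((dw q).mul (dw2 j q)).int ((cw q).mul (((hw q).Dx j).Dx j).continuous) ht
  have ib : ∀ q j, Integrable fun x => u j (t, x) * Dx j (fun z => w q z * w q z) (t, x) :=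
    fun q j => ((du j).mul (dww j q)).int ((cu j).mul ((hww q).Dx j).continuous) ht
  have ib' : ∀ q j, Integrable fun x => Dx j (u j) (t, x) * (w q (t, x) * w q (t, x)) :=
    fun q j => ((du1 j j).mul ((dw q).mul (dw q))).int
      (((hu j).Dx j).continuous.mul ((cw q).mul (cw q))) ht
  have ic : ∀ q j, Integrable fun x => w q (t, x) * (w j (t, x) * Dx j (v q) (t, x)) :=
    fun q j => ((dw q).mul ((dw j).mul (dv1 j q))).int
      ((cw q).mul ((cw j).mul ((hv q).Dx j).continuous)) ht
  have ie : ∀ q, Integrable fun x => w q (t, x) * w q (t, x) := fun q =>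
    ((dw q).mul (dw q)).int ((cw q).mul (cw q)) ht
  have IA : Integrable fun x => ∑ q, ∑ j, w q (t, x) * Dx j (Dx j (w q)) (t, x) :=
    integrable_finsetSum _ fun q _ => integrable_finsetSum _ fun j _ => ia q j
  have IB : Integrable fun x => ∑ q, ∑ j, u j (t, x) * Dx j (fun z => w q z * w q z) (t, x) :=
    integrable_finsetSum _ fun q _ => integrable_finsetSum _ fun j _ => ib q j
  have IC : Integrable fun x => ∑ q, ∑ j, w q (t, x) * (w j (t, x) * Dx j (v q) (t, x)) :=
    integrable_finsetSum _ fun q _ => integrable_finsetSum _ fun j _ => ic q j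
  have IE : Integrable fun x => ∑ q, w q (t, x) * w q (t, x) :=
    integrable_finsetSum _ fun q _ => ie q
  have hA : ∫ x, ∑ q, ∑ j, w q (t, x) * Dx j (Dx j (w q)) (t, x) ≤ 0 := by
    rw [integral_finsetSum _ fun q _ => integrable_finsetSum _ fun j _ => ia q j]
    refine Finset.sum_nonpos fun q _ => ?_
    rw [integral_finsetSum _ fun j _ => ia q j]
    refine Finset.sum_nonpos fun j _ => ?_
    rw [ibp (hw q) ((hw q).Dx j) (dw q) (dw1 j q) j (dw1 j q) (dw2 j q) ht]
    exact neg_nonpos.2 (integral_nonneg fun x => mul_self_nonneg _)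
  have hB : ∫ x, ∑ q, ∑ j, u j (t, x) * Dx j (fun z => w q z * w q z) (t, x) = 0 := by
    rw [integral_finsetSum _ fun q _ => integrable_finsetSum _ fun j _ => ib q j]
    refine Finset.sum_eq_zero fun q _ => ?_
    rw [integral_finsetSum _ fun j _ => ib q j]
    have h : ∀ j, ∫ x, u j (t, x) * Dx j (fun z => w q z * w q z) (t, x) =
        - ∫ x, Dx j (u j) (t, x) * (w q (t, x) * w q (t, x)) := fun j =>
      ibp (hu j) (hww q) (du j) ((dw q).mul (dw q)) j (du1 j j) (dww j q) ht
    simp only [h]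
    rw [Finset.sum_neg_distrib, ← integral_finsetSum _ fun j _ => ib' q j]
    simp [← Finset.sum_mul, hdiv]
  have hC : ∫ x, -(∑ q, ∑ j, w q (t, x) * (w j (t, x) * Dx j (v q) (t, x))) ≤
      (d * M) * En w t := by
    unfold En
    rw [← integral_const_mul]
    refine integral_mono IC.neg (IE.const_mul _) fun x => ?_
    have hp : ∀ q j, -(w q (t, x) * (w j (t, x) * Dx j (v q) (t, x))) ≤
        M / 2 * (w q (t, x) * w q (t, x)) + M / 2 * (w j (t, x) * w j (t, x)) := by
      intro q j
      obtain ⟨h1, h2⟩ := abs_le.1 (hM j q x)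
      nlinarith [mul_nonneg (sub_nonneg.2 h2) (mul_self_nonneg (w q (t, x) - w j (t, x))),
        mul_nonneg (by linarith : 0 ≤ M + Dx j (v q) (t, x))
          (mul_self_nonneg (w q (t, x) + w j (t, x)))]
    simp only [← Finset.sum_neg_distrib]
    refine (Finset.sum_le_sum fun q _ => Finset.sum_le_sum fun j _ => hp q j).trans (le_of_eq ?_)
    simp only [Finset.sum_add_distrib, Finset.sum_const, Finset.card_univ, Fintype.card_fin,
      nsmul_eq_mul, ← Finset.mul_sum]
    ring
  have key : ∀ x, (∑ q, (ν * (∑ j, Dx j (Dx j (w q)) (t, x)) -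
      ∑ j, (u j (t, x) * Dx j (w q) (t, x) + w j (t, x) * Dx j (v q) (t, x))) *
        (w q (t, x) + w q (t, x))) =
      (2 * ν * (∑ q, ∑ j, w q (t, x) * Dx j (Dx j (w q)) (t, x)) -
       ∑ q, ∑ j, u j (t, x) * Dx j (fun z => w q z * w q z) (t, x)) +
       2 * -(∑ q, ∑ j, w q (t, x) * (w j (t, x) * Dx j (v q) (t, x))) := by
    intro x
    simp only [Dx_mul (hw _) (hw _)]
    simp only [Finset.mul_sum, ← Finset.sum_neg_distrib]
    rw [← Finset.sum_sub_distrib, ← Finset.sum_add_distrib]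
    refine Finset.sum_congr rfl fun q _ => ?_
    rw [← Finset.sum_sub_distrib, Finset.sum_mul, ← Finset.sum_sub_distrib,
      ← Finset.sum_add_distrib]
    refine Finset.sum_congr rfl fun j _ => ?_
    ring
  simp only [key]
  have J1 := IA.const_mul (2 * ν)
  have J2 : Integrable fun x => 2 * -(∑ q, ∑ j, w q (t, x) * (w j (t, x) * Dx j (v q) (t, x))) :=
    IC.neg.const_mul 2
  have J3 : Integrable fun x => 2 * ν * (∑ q, ∑ j, w q (t, x) * Dx j (Dx j (w q)) (t, x)) -
       ∑ q, ∑ j, u j (t, x) * Dx j (fun z => w q z * w q z) (t, x) := J1.sub IB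
  rw [integral_add J3 J2, integral_sub J1 IB, hB, integral_const_mul, integral_const_mul]
  nlinarith [mul_nonneg hν.le (neg_nonneg.2 hA)]

lemma final {u v : Fin d → ℝ × (Fin d → ℝ) → ℝ} {p : ℝ × (Fin d → ℝ) → ℝ} {ν : ℝ} (hν : 0 < ν)
    (hu : ∀ q, Sm (u q)) (hv : ∀ q, Sm (v q)) (hp : Sm p)
    (du : ∀ q, Dec T (u q)) (dv : ∀ q, Dec T (v q))
    (du1 : ∀ j q, Dec T (Dx j (u q))) (dv1 : ∀ j q, Dec T (Dx j (v q)))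
    (du2 : ∀ j q, Dec T (Dx j (Dx j (u q)))) (dv2 : ∀ j q, Dec T (Dx j (Dx j (v q))))
    (hdu : ∀ t ∈ Icc (0 : ℝ) T, ∀ x, ∑ q, Dx q (u q) (t, x) = 0)
    (hdv : ∀ t ∈ Icc (0 : ℝ) T, ∀ x, ∑ q, Dx q (v q) (t, x) = 0)
    (h0 : ∀ q x, u q (0, x) = v q (0, x))
    (heq : ∀ t ∈ Icc (0 : ℝ) T, ∀ x q, Dt (u q) (t, x) - Dt (v q) (t, x) =
      ν * (∑ j, Dx j (Dx j (u q)) (t, x)) - ν * (∑ j, Dx j (Dx j (v q)) (t, x)) -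
      (∑ j, u j (t, x) * Dx j (u q) (t, x) - ∑ j, v j (t, x) * Dx j (v q) (t, x)) -
      Dx q p (t, x)) :
    ∀ t ∈ Icc (0 : ℝ) T, ∀ x q, u q (t, x) = v q (t, x) := by
  let w : Fin d → ℝ × (Fin d → ℝ) → ℝ := fun q z => u q z - v q z
  have hw : ∀ q, Sm (w q) := fun q => (hu q).sub (hv q)
  have e1 : ∀ j q, Dx j (w q) = fun z => Dx j (u q) z - Dx j (v q) z := fun j q =>
    Dx_sub (hu q) (hv q) j
  have e2 : ∀ j q, Dx j (Dx j (w q)) = fun z => Dx j (Dx j (u q)) z - Dx j (Dx j (v q)) z :=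
    fun j q => by rw [e1]; exact Dx_sub ((hu q).Dx j) ((hv q).Dx j) j
  have dw : ∀ q, Dec T (w q) := fun q => (du q).sub (dv q)
  have dw1 : ∀ j q, Dec T (Dx j (w q)) := fun j q => by rw [e1]; exact (du1 j q).sub (dv1 j q)
  have dw2 : ∀ j q, Dec T (Dx j (Dx j (w q))) := fun j q => by
    rw [e2]; exact (du2 j q).sub (dv2 j q)
  let G : Fin d → ℝ × (Fin d → ℝ) → ℝ := fun q z => ν * (∑ j, Dx j (Dx j (w q)) z) -
      ∑ j, (u j z * Dx j (w q) z + w j z * Dx j (v q) z)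
  have hG : ∀ q, Continuous (G q) := by
    intro q
    have c1 := fun j => (((hw q).Dx j).Dx j).continuous
    have c2 := fun j => ((hw q).Dx j).continuous
    have c3 := fun j => ((hv q).Dx j).continuous
    have c4 := fun j => (hu j).continuous
    have c5 := fun j => (hw j).continuous
    exact (continuous_const.mul (continuous_finsetSum _ fun j _ => c1 j)).sub
      (continuous_finsetSum _ fun j _ => ((c4 j).mul (c2 j)).add ((c5 j).mul (c3 j)))
  have dG : ∀ q, Dec T (G q) := fun q =>
    ((Dec.sum _ fun j => dw2 j q).const_mul ν).sub
      (Dec.sum _ fun j => ((du j).mul (dw1 j q)).add ((dw j).mul (dv1 j q)))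
  have hdiv : ∀ t ∈ Icc (0 : ℝ) T, ∀ x, ∑ q, Dx q (w q) (t, x) = 0 := by
    intro t ht x
    simp only [e1]
    rw [Finset.sum_sub_distrib, hdu t ht, hdv t ht, sub_zero]
  have heq' : ∀ t ∈ Icc (0 : ℝ) T, ∀ x q, Dt (w q) (t, x) = G q (t, x) - Dx q p (t, x) := by
    intro t ht x q
    have : Dt (w q) (t, x) = Dt (u q) (t, x) - Dt (v q) (t, x) := by
      rw [show Dt (w q) = _ from Dt_sub (hu q) (hv q)]
    rw [this, heq t ht x q]
    simp only [G, e2]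
    simp only [e1, w]
    rw [← mul_sub, ← Finset.sum_sub_distrib, ← Finset.sum_sub_distrib]
    congr 2
    refine Finset.sum_congr rfl fun j _ => ?_
    ring
  choose B hB0 hB using fun jq : Fin d × Fin d => (dv1 jq.1 jq.2).bdd
  have hM : ∀ t ∈ Icc (0:ℝ) T, ∀ j q x, |Dx j (v q) (t, x)| ≤ ∑ jq, B jq := fun t ht j q x =>
    (hB (j, q) t ht x).trans (Finset.single_le_sum (fun i _ => hB0 i) (Finset.mem_univ (j, q)))
  have hEc : ContinuousOn (En w) (Icc 0 T) :=
    (Dec.sum Finset.univ fun q => (dw q).mul (dw q)).cont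
      (continuous_finsetSum _ fun q _ => (hw q).continuous.mul (hw q).continuous)
  have hE0 : En w 0 ≤ 0 := by simp [En, w, h0]
  have gr := le_gronwallBound_of_liminf_deriv_right_le (f := En w)
    (f' := fun t => ∫ x, ∑ q, G q (t, x) * (w q (t, x) + w q (t, x)))
    (K := 2 * d * ∑ jq, B jq) (ε := 0) (δ := 0) hEc
    (fun t ht r hr => ((energy_slope hw dw (fun q => dw1 q q) hG dG hp hdiv heq' ht).eventually
      (gt_mem_nhds hr)).frequently) hE0
    (fun t ht => by
      have ht' := Ico_subset_Icc_self ht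
      rw [add_zero]
      exact energy_ineq hν hu hw hv du dw du1 dw1 dv1 dw2 ht' (hdu t ht') (hM t ht'))
  intro t ht x q
  have hE : En w t ≤ 0 := by
    have := gr t ht
    simpa [gronwallBound_ε0] using this
  have hnn : ∀ y, 0 ≤ ∑ q, w q (t, y) * w q (t, y) := fun y =>
    Finset.sum_nonneg fun q _ => mul_self_nonneg _
  have hE' : ∫ y, ∑ q, w q (t, y) * w q (t, y) = 0 := le_antisymm hE (integral_nonneg hnn)
  have hint : Integrable fun y => ∑ q, w q (t, y) * w q (t, y) :=
    integrable_finsetSum _ fun q _ =>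
      ((dw q).mul (dw q)).int ((hw q).continuous.mul (hw q).continuous) ht
  have hae := (integral_eq_zero_iff_of_nonneg hnn hint).1 hE'
  have hcont : Continuous fun y => ∑ q, w q (t, y) * w q (t, y) :=
    continuous_finsetSum _ fun q _ =>
      ((hw q).slice t).continuous.mul ((hw q).slice t).continuous
  have hz := congrFun ((hcont.ae_eq_iff_eq volume continuous_zero).1 hae) x
  have := (Finset.sum_eq_zero_iff_of_nonneg fun q _ => mul_self_nonneg (w q (t, x))).1 hz q
    (Finset.mem_univ q)
  exact sub_eq_zero.1 (mul_self_eq_zero.1 this)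

lemma dec012 {u : ℝ → (Fin d → ℝ) → Fin d → ℝ}
    (hu : ∀ q : Fin d, ContDiff ℝ (⊤ : ℕ∞) (fun z : ℝ × (Fin d → ℝ) => u z.1 z.2 q))
    (hdecu : ∀ α : Fin d → ℕ, ∀ k : ℕ, ∃ C : ℝ,
      ∀ t ∈ Set.Icc (0 : ℝ) T, ∀ x, ∀ q : Fin d,
        jap x ^ (k : ℝ) * |pdm α (fun y => u t y q) x| ≤ C) (q : Fin d) :
    Dec T (fun z => u z.1 z.2 q) ∧ (∀ j, Dec T (Dx j (fun z => u z.1 z.2 q))) ∧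
      ∀ j, Dec T (Dx j (Dx j (fun z => u z.1 z.2 q))) := by
  have p1 : ∀ t j, pd j (fun y => u t y q) = fun x => Dx j (fun z => u z.1 z.2 q) (t, x) :=
    fun t j => pd_slice (hu q) t j
  have p2 : ∀ t j, pd j (fun x => Dx j (fun z => u z.1 z.2 q) (t, x)) =
      fun x => Dx j (Dx j (fun z => u z.1 z.2 q)) (t, x) :=
    fun t j => pd_slice (Sm.Dx (hu q) j) t j
  refine ⟨dec_of_jap fun k => ?_, fun j => dec_of_jap fun k => ?_, fun j => dec_of_jap fun k => ?_⟩
  · obtain ⟨C, hC⟩ := hdecu (Pi.single q 0) k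
    refine ⟨C, fun t ht x => ?_⟩
    have := hC t ht x q
    rwa [pdm_single] at this
  · obtain ⟨C, hC⟩ := hdecu (Pi.single j 1) k
    refine ⟨C, fun t ht x => ?_⟩
    have := hC t ht x q
    rwa [pdm_single, Function.iterate_one, p1] at this
  · obtain ⟨C, hC⟩ := hdecu (Pi.single j 2) k
    refine ⟨C, fun t ht x => ?_⟩
    have := hC t ht x q
    rwa [pdm_single, Function.iterate_succ_apply, Function.iterate_one, p1, p2] at this

end NSU

theorem stmt12 (d : ℕ) (hd : 2 ≤ d) (ν T : ℝ) (hν : 0 < ν) (hT : 0 < T)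
    (u v : ℝ → (Fin d → ℝ) → Fin d → ℝ) (P Q : ℝ → (Fin d → ℝ) → ℝ)
    (hu : ∀ q : Fin d, ContDiff ℝ (⊤ : ℕ∞) (fun z : ℝ × (Fin d → ℝ) => u z.1 z.2 q))
    (hv : ∀ q : Fin d, ContDiff ℝ (⊤ : ℕ∞) (fun z : ℝ × (Fin d → ℝ) => v z.1 z.2 q))
    (hP : ContDiff ℝ (⊤ : ℕ∞) (fun z : ℝ × (Fin d → ℝ) => P z.1 z.2))
    (hQ : ContDiff ℝ (⊤ : ℕ∞) (fun z : ℝ × (Fin d → ℝ) => Q z.1 z.2))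
    (hdivu : ∀ t ∈ Set.Icc (0 : ℝ) T, ∀ x, ∑ j : Fin d, pd j (fun y => u t y j) x = 0)
    (hdivv : ∀ t ∈ Set.Icc (0 : ℝ) T, ∀ x, ∑ j : Fin d, pd j (fun y => v t y j) x = 0)
    (hNSu : ∀ t ∈ Set.Icc (0 : ℝ) T, ∀ x, ∀ q : Fin d,
      deriv (fun s => u s x q) t + ∑ j : Fin d, u t x j * pd j (fun y => u t y q) x =
        ν * (∑ j : Fin d, pd j (pd j (fun y => u t y q)) x) - pd q (P t) x)
    (hNSv : ∀ t ∈ Set.Icc (0 : ℝ) T, ∀ x, ∀ q : Fin d,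
      deriv (fun s => v s x q) t + ∑ j : Fin d, v t x j * pd j (fun y => v t y q) x =
        ν * (∑ j : Fin d, pd j (pd j (fun y => v t y q)) x) - pd q (Q t) x)
    (hinit : ∀ x, u 0 x = v 0 x)
    (hdecu : ∀ α : Fin d → ℕ, ∀ k : ℕ, ∃ C : ℝ,
      ∀ t ∈ Set.Icc (0 : ℝ) T, ∀ x, ∀ q : Fin d,
        jap x ^ (k : ℝ) * |pdm α (fun y => u t y q) x| ≤ C)
    (hdecv : ∀ α : Fin d → ℕ, ∀ k : ℕ, ∃ C : ℝ,
      ∀ t ∈ Set.Icc (0 : ℝ) T, ∀ x, ∀ q : Fin d,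
        jap x ^ (k : ℝ) * |pdm α (fun y => v t y q) x| ≤ C)
    (hPdec : ∀ t ∈ Set.Icc (0 : ℝ) T,
      Filter.Tendsto (P t) (Filter.cocompact (Fin d → ℝ)) (nhds 0))
    (hQdec : ∀ t ∈ Set.Icc (0 : ℝ) T,
      Filter.Tendsto (Q t) (Filter.cocompact (Fin d → ℝ)) (nhds 0)) :
    ∀ t ∈ Set.Icc (0 : ℝ) T, ∀ x, u t x = v t x := by
  have P1 : ∀ (f : ℝ → (Fin d → ℝ) → ℝ), NSU.Sm (fun z : ℝ × (Fin d → ℝ) => f z.1 z.2) →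
      ∀ t j, pd j (f t) = fun x => NSU.Dx j (fun z => f z.1 z.2) (t, x) :=
    fun f hf t j => NSU.pd_slice hf t j
  have P2 : ∀ (f : ℝ → (Fin d → ℝ) → ℝ), NSU.Sm (fun z : ℝ × (Fin d → ℝ) => f z.1 z.2) →
      ∀ t j, pd j (pd j (f t)) = fun x => NSU.Dx j (NSU.Dx j (fun z => f z.1 z.2)) (t, x) := by
    intro f hf t j
    rw [P1 f hf]
    exact NSU.pd_slice (NSU.Sm.Dx hf j) t j
  have P3 : ∀ (f : ℝ → (Fin d → ℝ) → ℝ), NSU.Sm (fun z : ℝ × (Fin d → ℝ) => f z.1 z.2) →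
      ∀ t x, deriv (fun s => f s x) t = NSU.Dt (fun z => f z.1 z.2) (t, x) :=
    fun f hf t x => (NSU.hasD_time hf t x).deriv
  have u1 := fun t j q => P1 (fun t y => u t y q) (hu q) t j
  have v1 := fun t j q => P1 (fun t y => v t y q) (hv q) t j
  have u2 := fun t j q => P2 (fun t y => u t y q) (hu q) t j
  have v2 := fun t j q => P2 (fun t y => v t y q) (hv q) t j
  have u3 := fun t x q => P3 (fun t y => u t y q) (hu q) t x
  have v3 := fun t x q => P3 (fun t y => v t y q) (hv q) t x
  have p1 := fun t j => P1 P hP t j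
  have q1 := fun t j => P1 Q hQ t j
  simp only [u2] at hNSu
  simp only [u1, u3, p1] at hNSu
  simp only [v2] at hNSv
  simp only [v1, v3, q1] at hNSv
  simp only [u1] at hdivu
  simp only [v1] at hdivv
  have DU := fun q => NSU.dec012 hu hdecu q
  have DV := fun q => NSU.dec012 hv hdecv q
  intro t ht x
  funext q
  refine NSU.final (T := T) (u := fun q z => u z.1 z.2 q) (v := fun q z => v z.1 z.2 q)
    (p := fun z => P z.1 z.2 - Q z.1 z.2) hν hu hv (hP.sub hQ)
    (fun q => (DU q).1) (fun q => (DV q).1) (fun j q => (DU q).2.1 j) (fun j q => (DV q).2.1 j)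
    (fun j q => (DU q).2.2 j) (fun j q => (DV q).2.2 j) hdivu hdivv
    (fun q x => congrFun (hinit x) q) ?_ t ht x q
  intro t ht x q
  have h1 := hNSu t ht x q
  have h2 := hNSv t ht x q
  rw [NSU.Dx_sub hP hQ]
  beta_reduce
  linarith
end
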